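/- (Path Replacement Lemma, existence form) Let G be a finite simple 3-connected graph with an edge ru and let D be a Mondshein sequence of G avoiding ru. Let G' be obtained from G by applying a single BG-operation, and let ru' be the edge of G' corresponding to ru (namely ru itself, or rv if the operation subdivides ru with v, or rw if it subdivides ru with w). Then G' has a Mondshein sequence avoiding ru'. -/

import Mathlib

open SimpleGraph

universe u

variable {V : Type u}

/-- An ear decomposition `(P₀, P₁, …, P_k)` of a graph `G`: `P₀` is a cycle and each
subsequent ear `Pᵢ` (`1 ≤ i ≤ k`, here indexed by `Fin k`) is a path that intersects the
union of the previous ears exactly in its two endpoints; the edge sets of the ears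
partition the edge set of `G`. -/
structure EarDecomposition {V : Type u} (G : SimpleGraph V) where
  /-- the number of path-ears; the ears are `P₀, P₁, …, P_k`. -/
  k : ℕ
  /-- base point of the initial cycle `P₀` -/
  v0 : V
  /-- the initial ear `P₀` -/
  cycle : G.Walk v0 v0
  cycle_isCycle : cycle.IsCycle
  /-- the first endpoint of the ear `Pᵢ` -/
  s : Fin k → V
  /-- the second endpoint of the ear `Pᵢ` -/
  t : Fin k → V
  /-- the ear `Pᵢ`, `1 ≤ i ≤ k` (indexed here by `i-1 : Fin k`) -/
  path : (i : Fin k) → G.Walk (s i) (t i)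
  path_isPath : ∀ i, (path i).IsPath
  path_length_pos : ∀ i, 0 < (path i).length
  /-- the ears cover all edges of `G` -/
  edges_cover : ∀ e ∈ G.edgeSet, e ∈ cycle.edges ∨ ∃ i, e ∈ (path i).edges
  /-- distinct ears have disjoint edge sets -/
  cycle_path_disjoint : ∀ (i : Fin k), ∀ e ∈ (path i).edges, e ∉ cycle.edges
  path_path_disjoint : ∀ i j : Fin k, i ≠ j → ∀ e ∈ (path i).edges, e ∉ (path j).edges
  /-- each ear intersects the union of the previous ears exactly in its endpoints -/
  meets_prev : ∀ (i : Fin k), ∀ x ∈ (path i).support,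
    ((x ∈ cycle.support ∨ ∃ j, j < i ∧ x ∈ (path j).support) ↔ (x = s i ∨ x = t i))

namespace EarDecomposition

variable {G : SimpleGraph V} (D : EarDecomposition G)

/-- The `i`-th ear `Pᵢ` as a subgraph of `G` (`P₀` is the initial cycle). -/
def ear (i : ℕ) : G.Subgraph :=
  if i = 0 then D.cycle.toSubgraph
  else if h : i - 1 < D.k then (D.path ⟨i - 1, h⟩).toSubgraph else ⊥

/-- The vertex set of the `i`-th ear. -/
def earSupport (i : ℕ) : Set V := (D.ear i).verts

/-- The edge set of the `i`-th ear. -/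
def earEdges (i : ℕ) : Set (Sym2 V) := (D.ear i).edgeSet

/-- The set of inner vertices of the `i`-th ear: for a path-ear, the vertices that are
not endpoints; every vertex of the initial cycle `P₀` counts as inner. -/
def inner (i : ℕ) : Set V :=
  if i = 0 then D.earSupport 0
  else if h : i - 1 < D.k then
    {x | x ∈ (D.path ⟨i - 1, h⟩).support ∧ x ≠ D.s ⟨i - 1, h⟩ ∧ x ≠ D.t ⟨i - 1, h⟩}
  else ∅

/-- Ear `Pᵢ` is long if it is not a single edge. -/
def IsLong (i : ℕ) : Prop :=
  i = 0 ∨ ∃ h : i - 1 < D.k, 2 ≤ (D.path ⟨i - 1, h⟩).length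

/-- The subgraph `G_i = P₀ ∪ P₁ ∪ ⋯ ∪ P_i`. -/
def partialGraph (i : ℕ) : G.Subgraph := ⨆ j ∈ Finset.range (i + 1), D.ear j

/-- `V̄ᵢ = V(G) − V(G_i)`. -/
def Vbar (i : ℕ) : Set V := (D.partialGraph i).vertsᶜ

/-- `Ḡᵢ`, the subgraph of `G` induced by `V̄ᵢ`. -/
def Gbar (i : ℕ) : G.Subgraph := (⊤ : G.Subgraph).induce (D.Vbar i)

/-- An ear decomposition is non-separating if, for every `i`, every inner vertex of `Pᵢ`
has a neighbor in `Ḡᵢ` unless `Ḡᵢ` is empty. -/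
def NonSeparating : Prop :=
  ∀ i ≤ D.k, (D.Vbar i).Nonempty → ∀ x ∈ D.inner i, ∃ y ∈ D.Vbar i, G.Adj x y

/-- `birth v` is the minimal `i` such that `Pᵢ` contains `v`. -/
noncomputable def birth (v : V) : ℕ := sInf {i | v ∈ D.earSupport i}

/-- `birthEdge e` is the index `i` such that `Pᵢ` contains the edge `e`. -/
noncomputable def birthEdge (e : Sym2 V) : ℕ := sInf {i | e ∈ D.earEdges i}

end EarDecomposition

/-- A graph is `k`-connected if it has more than `k` vertices and deleting any set of
fewer than `k` vertices leaves it connected. -/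
def KConnected (k : ℕ) (G : SimpleGraph V) : Prop :=
  k + 1 ≤ Nat.card V ∧ ∀ S : Set V, S.ncard < k → (G.induce Sᶜ).Connected

/-- A Mondshein sequence avoiding the edge `ru`: an ear decomposition of `G` such that
(1) `r ∈ P₀`; (2) `P_{birth u}` is the last long ear, contains `u` as its only inner
vertex and does not contain the edge `ru`; (3) the decomposition is non-separating. -/
def IsMondshein {G : SimpleGraph V} (D : EarDecomposition G) (r u : V) : Prop :=
  r ∈ D.earSupport 0 ∧
  D.IsLong (D.birth u) ∧
  (∀ j ≤ D.k, D.IsLong j → j ≤ D.birth u) ∧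
  D.inner (D.birth u) = {u} ∧
  s(r, u) ∉ D.earEdges (D.birth u) ∧
  D.NonSeparating

section BGOperations

variable {W : Type u}

/-- Vertex-vertex-addition: `G'` is obtained from `G` by adding an edge between two
distinct non-adjacent vertices. -/
def IsVVAdd (G : SimpleGraph V) (G' : SimpleGraph W) : Prop :=
  ∃ (e : V ≃ W) (x y : V), x ≠ y ∧ ¬G.Adj x y ∧
    ∀ z z' : V, G'.Adj (e z) (e z') ↔ (G.Adj z z' ∨ (z = x ∧ z' = y) ∨ (z = y ∧ z' = x))

/-- Edge-vertex-addition: `G'` is obtained from `G` by subdividing an edge `ab`, `a ≠ b`,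
by a new vertex `v` and adding the edge `vw` for a vertex `w ∉ {a, b}`. -/
def IsEVAdd (G : SimpleGraph V) (G' : SimpleGraph W) : Prop :=
  ∃ (f : V ↪ W) (v : W) (a b w : V),
    (∀ x, f x ≠ v) ∧ (∀ z : W, z = v ∨ ∃ x, f x = z) ∧
    G.Adj a b ∧ w ≠ a ∧ w ≠ b ∧
    (∀ x y : V, G'.Adj (f x) (f y) ↔ (G.Adj x y ∧ s(x, y) ≠ s(a, b))) ∧
    (∀ x : V, G'.Adj v (f x) ↔ (x = a ∨ x = b ∨ x = w))

/-- Edge-edge-addition: `G'` is obtained from `G` by subdividing two distinct edges `ab`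
and `cd` by new vertices `v` and `w`, respectively, and adding the edge `vw`. -/
def IsEEAdd (G : SimpleGraph V) (G' : SimpleGraph W) : Prop :=
  ∃ (f : V ↪ W) (v w : W) (a b c d : V),
    v ≠ w ∧ (∀ x, f x ≠ v ∧ f x ≠ w) ∧ (∀ z : W, z = v ∨ z = w ∨ ∃ x, f x = z) ∧
    G.Adj a b ∧ G.Adj c d ∧ s(a, b) ≠ s(c, d) ∧
    (∀ x y : V, G'.Adj (f x) (f y) ↔ (G.Adj x y ∧ s(x, y) ≠ s(a, b) ∧ s(x, y) ≠ s(c, d))) ∧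
    (∀ x : V, G'.Adj v (f x) ↔ (x = a ∨ x = b)) ∧
    (∀ x : V, G'.Adj w (f x) ↔ (x = c ∨ x = d)) ∧
    G'.Adj v w

/-- `G'` is obtained from `G` by a single BG-operation. -/
def IsBGOp (G : SimpleGraph V) (G' : SimpleGraph W) : Prop :=
  IsVVAdd G G' ∨ IsEVAdd G G' ∨ IsEEAdd G G'

/-- The graphs constructible from `K₄` by a sequence of BG-operations. -/
inductive BGConstructible : (Σ V : Type u, SimpleGraph V) → Prop
  | base {V : Type u} (G : SimpleGraph V) (h : Nonempty (G ≃g completeGraph (Fin 4))) :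
      BGConstructible ⟨V, G⟩
  | step {V W : Type u} (G : SimpleGraph V) (G' : SimpleGraph W)
      (hG : BGConstructible ⟨V, G⟩) (hop : IsBGOp G G') : BGConstructible ⟨W, G'⟩

end BGOperations

variable {V : Type u}

namespace Mond

/-- `Wk R s L t`: the sequence `s, L, t` is a walk with respect to `R`. -/
def Wk {V : Type u} (R : V → V → Prop) : V → List V → V → Prop
  | s, [], t => R s t
  | s, x :: L, t => R s x ∧ Wk R x L t

theorem Wk_append {V : Type u} {R : V → V → Prop} {s t x : V} {X Y : List V} :
    Wk R s (X ++ x :: Y) t ↔ Wk R s X x ∧ Wk R x Y t := by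
  induction X generalizing s with
  | nil => simp [Wk]
  | cons z X ih => simp [Wk, ih, and_assoc]

theorem Wk_snoc {V : Type u} {R : V → V → Prop} {s t x : V} {X : List V} :
    Wk R s (X ++ [x]) t ↔ Wk R s X x ∧ R x t := by
  rw [Wk_append]; rfl

theorem Wk_reverse {V : Type u} {R : V → V → Prop} (hR : ∀ x y, R x y → R y x) {s t : V}
    {L : List V} (h : Wk R s L t) : Wk R t L.reverse s := by
  induction L generalizing s with
  | nil => exact hR _ _ h
  | cons x L ih =>
    rw [List.reverse_cons, Wk_snoc]
    exact ⟨ih h.2, hR _ _ h.1⟩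

theorem Wk_mono {V : Type u} {R R' : V → V → Prop} {s t : V} {L : List V} (h : Wk R' s L t)
    (P : V → Prop) (hs : P s) (ht : P t) (hL : ∀ x ∈ L, P x)
    (hR : ∀ x y, P x → P y → R' x y → R x y) : Wk R s L t := by
  induction L generalizing s with
  | nil => exact hR _ _ hs ht h
  | cons x L ih =>
    refine ⟨hR _ _ hs (hL _ (by simp)) h.1, ih h.2 (hL _ (by simp)) fun y hy => hL _ (by simp [hy])⟩

/-- mono where each consecutive pair has a member in `L` -/
theorem Wk_mono' {V : Type u} {R R' : V → V → Prop} {s t : V} {L : List V} (h : Wk R' s L t)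
    (hne : L ≠ [])
    (hR : ∀ x y, (x = s ∨ x ∈ L) → (y = t ∨ y ∈ L) → (x ∈ L ∨ y ∈ L) → R' x y → R x y) :
    Wk R s L t := by
  induction L generalizing s with
  | nil => exact absurd rfl hne
  | cons x L ih =>
    refine ⟨hR _ _ (by simp) (by simp) (by simp) h.1, ?_⟩
    cases L with
    | nil => exact hR _ _ (by simp) (by simp) (by simp) h.2
    | cons z L =>
      refine ih h.2 (by simp) fun p q hp hq hpq hr => hR p q ?_ ?_ ?_ hr <;> grind

theorem Wk_last {V : Type u} {R : V → V → Prop} {s t : V} {L : List V} (h : Wk R s L t)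
    (hne : L ≠ []) : ∃ y ∈ L, R y t := by
  obtain ⟨X, x, rfl⟩ := List.eq_nil_or_concat L |>.resolve_left hne
  rw [List.concat_eq_append, Wk_snoc] at h
  exact ⟨x, by simp, h.2⟩

theorem Wk_head {V : Type u} {R : V → V → Prop} {s t : V} {L : List V} (h : Wk R s L t)
    (hne : L ≠ []) : ∃ y ∈ L, R s y := by
  cases L with
  | nil => exact absurd rfl hne
  | cons x L => exact ⟨x, by simp, h.1⟩

/-- If `R'` is `R` plus the edge `ab`, a path in `R'` is a path in `R` or becomes
one after subdividing `ab` with `v`. -/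
theorem Wk_insert {V : Type u} {R R' : V → V → Prop} {s t a b v : V} {L : List V}
    (hR : ∀ x y, R' x y → R x y ∨ (x = a ∧ y = b) ∨ (x = b ∧ y = a))
    (hav : R a v) (hbv : R b v) (hva : R v a) (hvb : R v b)
    (h : Wk R' s L t) (hnd : L.Nodup) (hs : s ∉ L) (ht : t ∉ L) (hst : s ≠ t ∨ 2 ≤ L.length) :
    Wk R s L t ∨ ∃ X Y p q, L = X ++ Y ∧ ((X = [] ∧ s = p) ∨ ∃ X', X = X' ++ [p]) ∧
      ((Y = [] ∧ t = q) ∨ ∃ Y', Y = q :: Y') ∧ ((p = a ∧ q = b) ∨ (p = b ∧ q = a)) ∧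
      Wk R s X v ∧ Wk R v Y t := by
  induction L generalizing s with
  | nil =>
    rcases hR _ _ h with h | h | h
    · exact Or.inl h
    · exact Or.inr ⟨[], [], s, t, by simp, by simp, by simp, Or.inl h, by simp [Wk, h, hav],
        by simp [Wk, h, hvb]⟩
    · exact Or.inr ⟨[], [], s, t, by simp, by simp, by simp, Or.inr h, by simp [Wk, h, hbv],
        by simp [Wk, h, hva]⟩
  | cons x L ih =>
    have hx : x ≠ t := by grind
    by_cases hsx : (s = a ∧ x = b) ∨ (s = b ∧ x = a)
    · right
      refine ⟨[], x :: L, s, x, rfl, by simp, by simp, hsx, by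
        rcases hsx with h | h <;> simp [Wk, h, hav, hbv], ?_, ?_⟩
      · rcases hsx with h | h <;> simp [h, hva, hvb]
      · cases L with
        | nil =>
          have := hR _ _ h.2
          simp only [Wk] at *
          grind
        | cons y L =>
          refine ⟨?_, ?_⟩
          · have := hR _ _ h.2.1
            grind
          · refine Wk_mono h.2.2 (fun z => z ≠ x) (by grind) (by grind) (by grind) ?_
            intro p q hp hq hpq
            have := hR _ _ hpq
            grind
    · have hsx' : R s x := by have := hR _ _ h.1; grind
      rcases ih h.2 (by grind) (by grind) (by grind) (by grind) with h' | ⟨X, Y, p, q, h1, h2, h3, h4, h5, h6⟩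
      · exact Or.inl ⟨hsx', h'⟩
      · refine Or.inr ⟨x :: X, Y, p, q, by simp [h1], Or.inr ?_, h3, h4, ⟨hsx', h5⟩, h6⟩
        rcases h2 with ⟨rfl, rfl⟩ | ⟨X', rfl⟩
        · exact ⟨[], rfl⟩
        · exact ⟨x :: X', rfl⟩

/-- Sets of vertices built by a non-separating sequence of long ears starting at `r`. -/
inductive NS {V : Type u} (K : SimpleGraph V) (r : V) : Set V → Prop
  | base : NS K r {r}
  | step' {S : Set V} {s t : V} {L : List V} : NS K r S → Wk K.Adj s L t → L ≠ [] → L.Nodup →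
      (∀ x ∈ L, x ∉ S) → s ∈ S → t ∈ S → (s ≠ t ∨ (S = {r} ∧ 2 ≤ L.length)) →
      (∀ x ∈ L, ∃ y, K.Adj x y ∧ y ∉ S ∧ y ∉ L) → NS K r {x | x ∈ S ∨ x ∈ L}

theorem NS.step {V : Type u} {K : SimpleGraph V} {r : V} {S : Set V} (h : NS K r S)
    (s t : V) (L : List V) (T : Set V) (hT : ∀ x, x ∈ T ↔ x ∈ S ∨ x ∈ L)
    (hW : Wk K.Adj s L t) (hne : L ≠ []) (hnd : L.Nodup)
    (hL : ∀ x ∈ L, x ∉ S) (hs : s ∈ S) (ht : t ∈ S) (hst : s ≠ t ∨ (S = {r} ∧ 2 ≤ L.length))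
    (hl : ∀ x ∈ L, ∃ y, K.Adj x y ∧ y ∉ T) : NS K r T := by
  have : T = {x | x ∈ S ∨ x ∈ L} := by ext x; exact hT x
  subst this
  refine NS.step' h hW hne hnd hL hs ht hst fun x hx => ?_
  obtain ⟨y, h1, h2⟩ := hl x hx
  exact ⟨y, h1, by grind, by grind⟩

theorem NS.cast {V : Type u} {K : SimpleGraph V} {r : V} {S T : Set V} (h : NS K r S)
    (hT : ∀ x, x ∈ T ↔ x ∈ S) : NS K r T := by
  have : T = S := by ext x; exact hT x
  exact this ▸ h

theorem NS.r_mem {V : Type u} {K : SimpleGraph V} {r : V} {S : Set V} (h : NS K r S) : r ∈ S := by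
  induction h with
  | base => simp
  | step' => left; assumption

/-- Only `ab` becomes available; `v` has a later neighbour `z`. -/
theorem newA_only {V : Type u} {K : SimpleGraph V} {R' : V → V → Prop} {r a b v s t z : V}
    {S : Set V} {L : List V} (h : NS K r S)
    (hR : ∀ x y, R' x y → K.Adj x y ∨ (x = a ∧ y = b) ∨ (x = b ∧ y = a))
    (hva : K.Adj v a) (hvb : K.Adj v b) (hvz : K.Adj v z) (hab : a ≠ b)
    (hW : Wk R' s L t) (hne : L ≠ []) (hnd : L.Nodup)
    (hL : ∀ x ∈ L, x ∉ S) (hs : s ∈ S) (ht : t ∈ S) (hst : s ≠ t ∨ (S = {r} ∧ 2 ≤ L.length))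
    (hl : ∀ x ∈ L, ∃ y, K.Adj x y ∧ y ∉ S ∧ y ∉ L ∧ y ≠ v)
    (hvS : v ∉ S) (hvL : v ∉ L) (hz : z ∉ S) (hzL : z ∉ L)
    (ha : a ∈ S ∨ a ∈ L) (hb : b ∈ S ∨ b ∈ L) :
    NS K r {x | x ∈ S ∨ x ∈ L ∨ x = v} := by
  have hzv : v ≠ z := hvz.ne
  rcases Wk_insert hR hva.symm hvb.symm hva hvb hW hnd (by grind) (by grind) (by grind) with
    h' | ⟨X, Y, p, q, rfl, -, -, -, h5, h6⟩
  · have h1 := h.step s t L {x | x ∈ S ∨ x ∈ L} (by simp) h' hne hnd hL hs ht hst (by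
      intro x hx; obtain ⟨y, hy⟩ := hl x hx; exact ⟨y, by grind⟩)
    exact h1.step a b [v] _ (by simp [or_assoc]) ⟨hva.symm, hvb⟩ (by simp) (by simp) (by simp_all)
      ha hb (Or.inl hab) (by
        intro x hx; exact ⟨z, by grind⟩)
  · refine h.step s t (X ++ v :: Y) _ (by grind) (Wk_append.2 ⟨h5, h6⟩) (by simp) (by grind)
      (by grind) hs ht (by grind) ?_
    intro x hx
    by_cases hxv : x = v
    · exact ⟨z, by grind⟩
    · obtain ⟨y, hy⟩ := hl x (by grind)
      exact ⟨y, by grind⟩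

end Mond

namespace Mond

/-- `x` has a neighbour outside `T`. -/
def Lat {V : Type u} (K : SimpleGraph V) (T : Set V) (x : V) : Prop := ∃ y, K.Adj x y ∧ y ∉ T

/-- Common setting: `M` lists the new vertices, all but `v`, `w` have a later neighbour. -/
structure Ctx {V : Type u} (K : SimpleGraph V) (r : V) (S : Set V) (M : List V) (v w : V) : Prop where
  ns : NS K r S
  nd : M.Nodup
  dis : ∀ x ∈ M, x ∉ S
  lat : ∀ x ∈ M, x ≠ v → x ≠ w → Lat K {x | x ∈ S ∨ x ∈ M} x

/-- Admissible endpoints of an ear. -/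
def Ok {V : Type u} (r : V) (S : Set V) (s t : V) (n : ℕ) : Prop := s ≠ t ∨ (S = {r} ∧ 2 ≤ n)

section
variable {V : Type u} {K : SimpleGraph V} {r v w : V} {S : Set V} {M P : List V}

theorem Ctx.one (C : Ctx K r S M v w) (hP : P.Perm M)
    (s t : V) (L : List V) (hpm : L.Perm P)
    (hW : Wk K.Adj s L t) (hne : L ≠ []) (hs : s ∈ S) (ht : t ∈ S)
    (hst : Ok r S s t L.length)
    (hv : v ∈ L → Lat K {x | x ∈ S ∨ x ∈ M} v)
    (hw : w ∈ L → Lat K {x | x ∈ S ∨ x ∈ M} w) : NS K r {x | x ∈ S ∨ x ∈ M} := by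
  have hpm := hpm.trans hP
  have nd := hpm.nodup_iff.2 C.nd
  refine C.ns.step s t L _ (fun x => by simp [hpm.mem_iff]) hW hne nd
    (fun x hx => C.dis x (hpm.mem_iff.1 hx)) hs ht hst fun x hx => ?_
  by_cases h1 : x = v
  · exact h1 ▸ hv (h1 ▸ hx)
  by_cases h2 : x = w
  · exact h2 ▸ hw (h2 ▸ hx)
  exact C.lat x (hpm.mem_iff.1 hx) h1 h2

theorem Ctx.two (C : Ctx K r S M v w) (hP : P.Perm M)
    (s t : V) (L : List V) (s' t' : V) (L' : List V) (hpm : (L ++ L').Perm P)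
    (hW : Wk K.Adj s L t) (hW' : Wk K.Adj s' L' t') (hne : L ≠ []) (hne' : L' ≠ [])
    (hs : s ∈ S) (ht : t ∈ S) (hst : Ok r S s t L.length)
    (hs' : s' ∈ S ∨ s' ∈ L) (ht' : t' ∈ S ∨ t' ∈ L) (hst' : s' ≠ t')
    (hv : v ∈ L → Lat K {x | x ∈ S ∨ x ∈ M} v ∨ ∃ y ∈ L', K.Adj v y)
    (hv' : v ∈ L' → Lat K {x | x ∈ S ∨ x ∈ M} v)
    (hw : w ∈ L → Lat K {x | x ∈ S ∨ x ∈ M} w ∨ ∃ y ∈ L', K.Adj w y)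
    (hw' : w ∈ L' → Lat K {x | x ∈ S ∨ x ∈ M} w) : NS K r {x | x ∈ S ∨ x ∈ M} := by
  have hpm := hpm.trans hP
  have nd := hpm.nodup_iff.2 C.nd
  rw [List.nodup_append] at nd
  have hm : ∀ x, x ∈ M ↔ x ∈ L ∨ x ∈ L' := fun x => by rw [← hpm.mem_iff]; simp
  have lt : ∀ x ∈ M, (x = v → Lat K {x | x ∈ S ∨ x ∈ M} v ∨ ∃ y ∈ L', K.Adj v y) →
      (x = w → Lat K {x | x ∈ S ∨ x ∈ M} w ∨ ∃ y ∈ L', K.Adj w y) →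
      Lat K {x | x ∈ S ∨ x ∈ M} x ∨ ∃ y ∈ L', K.Adj x y := by
    intro x hx hv hw
    by_cases h1 : x = v
    · exact h1 ▸ hv h1
    by_cases h2 : x = w
    · exact h2 ▸ hw h2
    exact Or.inl (C.lat x hx h1 h2)
  have h1 := C.ns.step s t L {x | x ∈ S ∨ x ∈ L} (by simp) hW hne nd.1
    (fun x hx => C.dis x ((hm x).2 (Or.inl hx))) hs ht hst (by
    intro x hx
    rcases lt x ((hm x).2 (Or.inl hx)) (fun h => hv (h ▸ hx)) (fun h => hw (h ▸ hx)) with ⟨y, h1, h2⟩ | ⟨y, h1, h2⟩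
    · exact ⟨y, h1, fun h => h2 (h.imp_right fun h => (hm y).2 (Or.inl h))⟩
    · exact ⟨y, h2, fun h => h.elim (C.dis y ((hm y).2 (Or.inr h1))) (fun h => nd.2.2 _ h _ h1 rfl)⟩)
  refine h1.step s' t' L' _ (fun x => by simp [hm, or_assoc]) hW' hne' nd.2.1 ?_ hs' ht' (Or.inl hst') ?_
  · intro x hx h
    exact h.elim (C.dis x ((hm x).2 (Or.inr hx))) (fun h => nd.2.2 _ h _ hx rfl)
  · intro x hx
    by_cases h1 : x = v
    · exact h1 ▸ hv' (h1 ▸ hx)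
    by_cases h2 : x = w
    · exact h2 ▸ hw' (h2 ▸ hx)
    exact C.lat x ((hm x).2 (Or.inr hx)) h1 h2

theorem Ctx.three (C : Ctx K r S M v w) (hP : P.Perm M)
    (s t : V) (L : List V) (s' t' : V) (L' : List V) (s'' t'' : V) (L'' : List V)
    (hpm : (L ++ (L' ++ L'')).Perm P)
    (hW : Wk K.Adj s L t) (hW' : Wk K.Adj s' L' t') (hW'' : Wk K.Adj s'' L'' t'')
    (hne : L ≠ []) (hne' : L' ≠ []) (hne'' : L'' ≠ [])
    (hs : s ∈ S) (ht : t ∈ S) (hst : Ok r S s t L.length)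
    (hs' : s' ∈ S ∨ s' ∈ L) (ht' : t' ∈ S ∨ t' ∈ L) (hst' : s' ≠ t')
    (hs'' : (s'' ∈ S ∨ s'' ∈ L) ∨ s'' ∈ L') (ht'' : (t'' ∈ S ∨ t'' ∈ L) ∨ t'' ∈ L') (hst'' : s'' ≠ t'')
    (hv : v ∈ L → Lat K {x | x ∈ S ∨ x ∈ M} v ∨ ∃ y ∈ L' ++ L'', K.Adj v y)
    (hv' : v ∈ L' → Lat K {x | x ∈ S ∨ x ∈ M} v ∨ ∃ y ∈ L'', K.Adj v y)
    (hv'' : v ∈ L'' → Lat K {x | x ∈ S ∨ x ∈ M} v)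
    (hw : w ∈ L → Lat K {x | x ∈ S ∨ x ∈ M} w ∨ ∃ y ∈ L' ++ L'', K.Adj w y)
    (hw' : w ∈ L' → Lat K {x | x ∈ S ∨ x ∈ M} w ∨ ∃ y ∈ L'', K.Adj w y)
    (hw'' : w ∈ L'' → Lat K {x | x ∈ S ∨ x ∈ M} w) : NS K r {x | x ∈ S ∨ x ∈ M} := by
  have hpm := hpm.trans hP
  have nd := hpm.nodup_iff.2 C.nd
  rw [List.nodup_append] at nd
  have hm : ∀ x, x ∈ M ↔ x ∈ L ∨ x ∈ L' ++ L'' := fun x => by rw [← hpm.mem_iff]; simp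
  have h1 := C.ns.step s t L {x | x ∈ S ∨ x ∈ L} (by simp) hW hne nd.1
    (fun x hx => C.dis x ((hm x).2 (Or.inl hx))) hs ht hst (by
    intro x hx
    have : Lat K {x | x ∈ S ∨ x ∈ M} x ∨ ∃ y ∈ L' ++ L'', K.Adj x y := by
      by_cases h1 : x = v
      · exact h1 ▸ hv (h1 ▸ hx)
      by_cases h2 : x = w
      · exact h2 ▸ hw (h2 ▸ hx)
      exact Or.inl (C.lat x ((hm x).2 (Or.inl hx)) h1 h2)
    rcases this with ⟨y, h1, h2⟩ | ⟨y, h1, h2⟩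
    · exact ⟨y, h1, fun h => h2 (h.imp_right fun h => (hm y).2 (Or.inl h))⟩
    · exact ⟨y, h2, fun h => h.elim (C.dis y ((hm y).2 (Or.inr h1))) (fun h => nd.2.2 _ h _ h1 rfl)⟩)
  have hset : {x | x ∈ S ∨ x ∈ M} = {x | x ∈ {x | x ∈ S ∨ x ∈ L} ∨ x ∈ L' ++ L''} := by
    ext x
    simp only [Set.mem_setOf_eq, hm x, or_assoc]
  have C' : Ctx K r {x | x ∈ S ∨ x ∈ L} (L' ++ L'') v w := by
    refine ⟨h1, nd.2.1, ?_, ?_⟩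
    · intro x hx h
      exact h.elim (C.dis x ((hm x).2 (Or.inr hx))) (fun h => nd.2.2 _ h _ hx rfl)
    · intro x hx h1 h2
      rw [← hset]
      exact C.lat x ((hm x).2 (Or.inr hx)) h1 h2
  rw [hset] at hv' hw' hv'' hw'' ⊢
  exact C'.two (List.Perm.refl _) s' t' L' s'' t'' L'' (List.Perm.refl _) hW' hW'' hne' hne'' hs' ht'
    (Or.inl hst') hs'' ht'' hst'' hv' hv'' hw' hw''

end
end Mond

namespace Mond

/-- counting function -/
noncomputable def cnt {V : Type u} (z : V) (L : List V) : ℕ := by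
  classical exact L.count z

/-- indicator of equality -/
noncomputable def ind {V : Type u} (z x : V) : ℕ := by
  classical exact if x = z then 1 else 0

theorem cA {V : Type u} (z : V) (L M : List V) : cnt z (L ++ M) = cnt z L + cnt z M := by
  simp [cnt]

theorem cC {V : Type u} (z x : V) (L : List V) : cnt z (x :: L) = cnt z L + ind z x := by
  classical
  simp only [cnt, ind, List.count_cons]
  by_cases h : x = z <;> simp [h]

theorem cN {V : Type u} (z : V) : cnt z ([] : List V) = 0 := by
  simp [cnt]

theorem cR {V : Type u} (z : V) (L : List V) : cnt z L.reverse = cnt z L := by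
  simp [cnt]

theorem pm {V : Type u} {L M : List V} (h : ∀ z, cnt z L = cnt z M) : L.Perm M := by
  classical
  rw [List.perm_iff_count]
  intro z
  have := h z
  unfold cnt at this
  convert this

theorem Ok.symm {V : Type u} {r s t : V} {S : Set V} {n : ℕ} (h : Ok r S s t n) : Ok r S t s n :=
  h.imp Ne.symm id

theorem not_ok {V : Type u} {r s t : V} {S : Set V} {n : ℕ} (h : ¬ Ok r S s t n) (hn : 2 ≤ n) :
    s = t ∧ S ≠ {r} := by
  unfold Ok at h
  push Not at h
  exact ⟨h.1, fun h' => absurd (h.2 h') (by omega)⟩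

set_option maxHeartbeats 1000000 in
/-- `ab` becomes available while `w` is already there. -/
theorem newA {V : Type u} {K : SimpleGraph V} {R' : V → V → Prop} {r a b v s t w : V}
    {S : Set V} {M L : List V} (C : Ctx K r S M v v) (hP : (v :: L).Perm M)
    (hR : ∀ x y, R' x y → K.Adj x y ∨ (x = a ∧ y = b) ∨ (x = b ∧ y = a))
    (hva : K.Adj v a) (hvb : K.Adj v b) (hvw : K.Adj v w) (hab : a ≠ b)
    (hwa : w ≠ a) (hwb : w ≠ b)
    (hW : Wk R' s L t) (hne : L ≠ [])
    (hs : s ∈ S) (ht : t ∈ S) (hst : Ok r S s t L.length) (hw : w ∈ S)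
    (ha : a ∈ S ∨ a ∈ L) (hb : b ∈ S ∨ b ∈ L) (hnew : ¬ (a ∈ S ∧ b ∈ S)) :
    NS K r {x | x ∈ S ∨ x ∈ M} := by
  have hnd : (v :: L).Nodup := hP.nodup_iff.2 C.nd
  have hd : ∀ x ∈ v :: L, x ∉ S := fun x hx => C.dis x (hP.mem_iff.1 hx)
  have hS : S = {r} → ∀ x ∈ S, x = r := by grind
  rcases Wk_insert hR hva.symm hvb.symm hva hvb hW (by grind) (by grind) (by grind) (by grind [Ok]) with
    h' | ⟨X, Y, p, q, rfl, hX, hY, hpq, h5, h6⟩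
  · clear hW hR
    -- symmetric helper: both inner, `a` before `b`
    have key : ∀ (a b : V) (X Y Z : List V), L = X ++ a :: (Y ++ b :: Z) → K.Adj v a → K.Adj v b →
        NS K r {x | x ∈ S ∨ x ∈ M} := by
      intro a b X Y Z hLe hva hvb
      subst hLe
      rw [Wk_append, Wk_append] at h'
      obtain ⟨w1, w2, w3⟩ := h'
      by_cases hsw : Ok r S s w (X ++ a :: [v]).length
      · exact C.two hP s w (X ++ a :: [v]) a t (Y ++ b :: Z) (pm fun z => by simp only [cA, cC, cN]; omega)
          (Wk_append.2 ⟨w1, hva.symm, hvw⟩) (Wk_append.2 ⟨w2, w3⟩) (by simp) (by simp)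
          hs hw hsw (by simp) (Or.inl ht) (by grind)
          (fun _ => Or.inr ⟨b, by simp, hvb⟩) (by grind)
          (fun _ => Or.inr ⟨b, by simp, hvb⟩) (by grind)
      · obtain ⟨rfl, h0⟩ := not_ok hsw (by simp)
        have hst' : s ≠ t := hst.resolve_right fun h => h0 h.1
        exact C.two hP s t (v :: b :: Z) s b (X ++ a :: Y) (pm fun z => by simp only [cA, cC, cN]; omega)
          ⟨hvw.symm, hvb, w3⟩ (Wk_append.2 ⟨w1, w2⟩) (by simp) (by simp)
          hs ht (Or.inl hst') (Or.inl hs) (by simp) (by grind)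
          (fun _ => Or.inr ⟨a, by simp, hva⟩) (by grind)
          (fun _ => Or.inr ⟨a, by simp, hva⟩) (by grind)
    -- symmetric helper: `a` new, `b` old
    have key2 : ∀ (a b : V), a ∈ L → b ∈ S → w ≠ b → K.Adj v a → K.Adj v b →
        NS K r {x | x ∈ S ∨ x ∈ M} := by
      intro a b ha hb hwb hva hvb
      have hst' : s ≠ t := hst.resolve_right fun h => hwb (by rw [hS h.1 w hw, hS h.1 b hb])
      exact C.two hP b w [v] s t L (pm fun z => by simp only [cA, cC, cN]; omega)
        ⟨hvb.symm, hvw⟩ h' (by simp) hne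
        hb hw (Or.inl (Ne.symm hwb)) (Or.inl hs) (Or.inl ht) hst'
          (fun _ => Or.inr ⟨a, ha, hva⟩) (by grind)
          (fun _ => Or.inr ⟨a, ha, hva⟩) (by grind)
    by_cases haS : a ∈ S
    · exact key2 b a (by grind) haS hwa hvb hva
    · have haL : a ∈ L := by grind
      by_cases hbS : b ∈ S
      · exact key2 a b haL hbS hwb hva hvb
      · have hbL : b ∈ L := by grind
        obtain ⟨X, Y, hXY⟩ := List.append_of_mem haL
        by_cases hbX : b ∈ X
        · obtain ⟨X1, X2, rfl⟩ := List.append_of_mem hbX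
          exact key b a X1 X2 Y (by simp [hXY]) hvb hva
        · obtain ⟨Y1, Y2, rfl⟩ := List.append_of_mem (show b ∈ Y by grind)
          exact key a b X Y1 Y2 (by simp [hXY]) hva hvb
  · clear hW hR
    have hXY : X ≠ [] ∨ Y ≠ [] := by grind
    have hX1 : s = w → X ≠ [] := by
      rintro rfl rfl
      rcases hX with ⟨-, rfl⟩ | ⟨X', hX⟩
      · rcases hpq with h | h <;> tauto
      · simp at hX
    have hY1 : Y = [] → w ≠ t := by
      rintro rfl rfl
      rcases hY with ⟨-, rfl⟩ | ⟨X', hX⟩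
      · rcases hpq with h | h <;> tauto
      · simp at hX
    have hvY : v ∉ Y := fun h => by simp [h] at hnd
    have hvX : v ∉ X := fun h => by simp [h] at hnd
    have hvs : s ≠ v := fun h => hd v (by simp) (h ▸ hs)
    have hvt : v ≠ t := fun h => hd v (by simp) (h ▸ ht)
    clear hX hY
    by_cases hc : Y ≠ [] ∧ Ok r S s w (X ++ [v]).length
    · obtain ⟨y, hy, hvy⟩ := Wk_head h6 hc.1
      exact C.two hP s w (X ++ [v]) v t Y (pm fun z => by simp only [cA, cC, cN]; omega)
        (Wk_snoc.2 ⟨h5, hvw⟩) h6 (by simp) hc.1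
        hs hw hc.2 (by simp) (Or.inl ht) hvt
        (fun _ => Or.inr ⟨y, hy, hvy⟩) (absurd · hvY)
        (fun _ => Or.inr ⟨y, hy, hvy⟩) (absurd · hvY)
    · have hX0 : X ≠ [] ∧ w ≠ t := by
        by_cases h0 : Y = []
        · exact ⟨by tauto, hY1 h0⟩
        · have h1 : ¬ Ok r S s w (X ++ [v]).length := by tauto
          have h2 : s = w := by
            by_contra h; exact h1 (Or.inl h)
          have h3 := hX1 h2
          obtain ⟨-, h4⟩ := not_ok h1 (by cases X <;> simp_all)
          exact ⟨h3, h2 ▸ hst.resolve_right fun h => h4 h.1⟩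
      obtain ⟨y, hy, hvy⟩ := Wk_last h5 hX0.1
      exact C.two hP w t (v :: Y) s v X (pm fun z => by simp only [cA, cC, cN]; omega)
        ⟨hvw.symm, h6⟩ h5 (by simp) hX0.1
        hw ht (Or.inl hX0.2) (Or.inl hs) (by simp) hvs
        (fun _ => Or.inr ⟨y, hy, hvy.symm⟩) (absurd · hvX)
        (fun _ => Or.inr ⟨y, hy, hvy.symm⟩) (absurd · hvX)

end Mond

namespace Mond
section
variable {V : Type u} {K : SimpleGraph V} {r a b v s t w : V} {S : Set V} {M L X Y Z T : List V}

theorem Ok.len {n m : ℕ} (h : Ok r S s t n) (hm : 2 ≤ m) : Ok r S s t m :=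
  h.imp_right fun h => ⟨h.1, hm⟩

theorem Wk_symm (h : Wk K.Adj s L t) : Wk K.Adj t L.reverse s :=
  Wk_reverse (fun _ _ h => h.symm) h

theorem Ctx.nodup {P : List V} (C : Ctx K r S M v w) (hP : P.Perm M) : P.Nodup :=
  hP.nodup_iff.2 C.nd

theorem Ctx.disj {P : List V} (C : Ctx K r S M v w) (hP : P.Perm M) : ∀ x ∈ P, x ∉ S :=
  fun x hx => C.dis x (hP.mem_iff.1 hx)

theorem Aw1 (C : Ctx K r S M v w) (hP : (v :: (X ++ (Y ++ w :: Z))).Perm M)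
    (hvw : K.Adj v w) (h1 : Wk K.Adj s X v) (h2 : Wk K.Adj v (Y ++ w :: Z) t) (hY : Y ≠ [])
    (hs : s ∈ S) (ht : t ∈ S) (hst : Ok r S s t 2) : NS K r {x | x ∈ S ∨ x ∈ M} := by
  have hnd := C.nodup hP
  rw [Wk_append] at h2
  obtain ⟨y, hy, hvy⟩ := Wk_head h2.1 hY
  obtain ⟨z, hz, hwz⟩ := Wk_last h2.1 hY
  have h3 : v ∉ Y ∧ w ∉ Y := by clear * - hnd; grind
  exact C.two hP s t (X ++ v :: w :: Z) v w Y (pm fun z => by simp only [cA, cC, cN]; omega)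
    (Wk_append.2 ⟨h1, hvw, h2.2⟩) h2.1 (by simp) hY hs ht (hst.len (by simp; omega))
    (by simp) (by simp) hvw.ne
    (fun _ => Or.inr ⟨y, hy, hvy⟩) (absurd · h3.1) (fun _ => Or.inr ⟨z, hz, hwz.symm⟩) (absurd · h3.2)

theorem Aw2 (C : Ctx K r S M v w) (hP : (v :: (X ++ w :: (Y ++ a :: Z))).Perm M)
    (hvw : K.Adj v w) (hva : K.Adj v a) (hvb : K.Adj v b) (h : Wk K.Adj s (X ++ w :: (Y ++ a :: Z)) t)
    (hs : s ∈ S) (ht : t ∈ S) (hb : b ∈ S) (hst : Ok r S s t 2)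
    (Hw : Lat K {x | x ∈ S ∨ x ∈ M} w ∨ ¬ (K.Adj a w ∧ K.Adj b w)) :
    NS K r {x | x ∈ S ∨ x ∈ M} := by
  have hnd := C.nodup hP
  have hd := C.disj hP
  rw [Wk_append, Wk_append] at h
  obtain ⟨w1, w2, w3⟩ := h
  have hne : v ∉ X ∧ v ∉ Y ∧ v ∉ Z ∧ v ≠ w ∧ v ≠ a ∧ w ∉ X ∧ w ∉ Y ∧ w ∉ Z ∧ w ≠ a := by
    clear * - hnd; grind
  obtain ⟨n1, n2, n3, n4, n5, n6, n7, n8, n9⟩ := hne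
  have hwS : w ∉ S := hd _ (by simp)
  have hvS : v ∉ S := hd _ (by simp)
  have haS : a ∉ S := hd _ (by simp)
  have hwt : w ≠ t := fun h => hwS (h ▸ ht)
  have hsv : s ≠ v := fun h => hvS (h ▸ hs)
  have hsw : s ≠ w := fun h => hwS (h ▸ hs)
  have hsa : s ≠ a := fun h => haS (h ▸ hs)
  by_cases hok : Ok r S s b 2
  · have hwy : ∃ y ∈ Y ++ a :: Z, K.Adj w y := Wk_head (Wk_append.2 ⟨w2, w3⟩) (by simp)
    exact C.two hP s b (X ++ w :: [v]) w t (Y ++ a :: Z) (pm fun z => by simp only [cA, cC, cN]; omega)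
      (Wk_append.2 ⟨w1, hvw.symm, hvb⟩) (Wk_append.2 ⟨w2, w3⟩) (by simp) (by simp)
      hs hb (hok.len (by simp)) (by simp) (Or.inl ht) hwt
      (fun _ => Or.inr ⟨a, by simp, hva⟩) (by simp [n2, n3, n5])
      (fun _ => Or.inr hwy) (by simp [n7, n8, n9])
  · obtain ⟨rfl, h0⟩ := not_ok hok le_rfl
    have hst' : s ≠ t := hst.resolve_right fun h => h0 h.1
    by_cases hX : X = []
    · subst hX
      by_cases hY : Y = []
      · subst hY
        have hw : Lat K {x | x ∈ S ∨ x ∈ M} w := Hw.resolve_right fun h => h ⟨K.adj_symm w2, w1⟩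
        exact C.two hP s t (v :: a :: Z) s a [w] (pm fun z => by simp only [cA, cC, cN]; omega)
          ⟨hvb.symm, hva, w3⟩ ⟨w1, w2⟩ (by simp) (by simp) hs ht (Or.inl hst') (Or.inl hs) (by simp) hsa
          (fun _ => Or.inr ⟨w, by simp, hvw⟩) (by simp [n4]) (fun _ => Or.inl hw) (fun _ => hw)
      · have hwy := Wk_head w2 hY
        exact C.three hP s t (v :: a :: Z) s v [w] w a Y (pm fun z => by simp only [cA, cC, cN]; omega)
          ⟨hvb.symm, hva, w3⟩ ⟨w1, hvw.symm⟩ w2 (by simp) (by simp) hY hs ht (Or.inl hst')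
          (Or.inl hs) (by simp) hsv (by simp) (by simp) n9
          (fun _ => Or.inr ⟨w, by simp, hvw⟩) (by simp [n4]) (absurd · n2)
          (by simp [n4.symm, n9, n8]) (fun _ => Or.inr hwy) (absurd · n7)
    · obtain ⟨y, hy, hyw⟩ := Wk_last w1 hX
      exact C.three hP s t (v :: a :: Z) v a (w :: Y) s w X (pm fun z => by simp only [cA, cC, cN]; omega)
          ⟨hvb.symm, hva, w3⟩ ⟨hvw, w2⟩ w1 (by simp) (by simp) hX hs ht (Or.inl hst')
          (by simp) (by simp) n5 (by simp [hs]) (by simp) hsw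
          (fun _ => Or.inr ⟨w, by simp, hvw⟩) (by simp [n4, n2]) (absurd · n1)
          (by simp [n4.symm, n9, n8]) (fun _ => Or.inr ⟨y, hy, hyw.symm⟩) (absurd · n6)

theorem Aw3 (C : Ctx K r S M v w) (hP : (v :: (X ++ a :: (Y ++ b :: (Z ++ w :: T)))).Perm M)
    (hvw : K.Adj v w) (hva : K.Adj v a) (hvb : K.Adj v b)
    (h : Wk K.Adj s (X ++ a :: (Y ++ b :: (Z ++ w :: T))) t)
    (hs : s ∈ S) (ht : t ∈ S) (hst : Ok r S s t 2) :
    NS K r {x | x ∈ S ∨ x ∈ M} := by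
  have hnd := C.nodup hP
  rw [Wk_append, Wk_append, Wk_append] at h
  obtain ⟨w1, w2, w3, w4⟩ := h
  have hne : v ∉ Y ∧ v ∉ Z ∧ v ≠ b ∧ w ∉ Y ∧ w ∉ Z ∧ w ≠ b ∧ a ≠ w := by
    clear * - hnd; grind
  obtain ⟨n1, n2, n3, n4, n5, n6, n7⟩ := hne
  have w23 : Wk K.Adj a (Y ++ b :: Z) w := Wk_append.2 ⟨w2, w3⟩
  obtain ⟨y, hy, hyw⟩ := Wk_last w23 (by simp)
  exact C.two hP s t (X ++ a :: v :: w :: T) a w (Y ++ b :: Z) (pm fun z => by simp only [cA, cC, cN]; omega)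
    (Wk_append.2 ⟨w1, hva.symm, hvw, w4⟩) w23 (by simp) (by simp) hs ht (hst.len (by simp; omega))
    (by simp) (by simp) n7
    (fun _ => Or.inr ⟨b, by simp, hvb⟩) (by simp [n1, n2, n3])
    (fun _ => Or.inr ⟨y, hy, hyw.symm⟩) (by simp [n4, n5, n6])

theorem Aw4 (C : Ctx K r S M v w) (hP : (v :: (X ++ a :: (Y ++ w :: (Z ++ b :: T)))).Perm M)
    (hvw : K.Adj v w) (hva : K.Adj v a) (hvb : K.Adj v b)
    (h : Wk K.Adj s (X ++ a :: (Y ++ w :: (Z ++ b :: T))) t)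
    (hs : s ∈ S) (ht : t ∈ S) (hst : Ok r S s t 2)
    (Hw : Lat K {x | x ∈ S ∨ x ∈ M} w ∨ ¬ (K.Adj a w ∧ K.Adj b w)) :
    NS K r {x | x ∈ S ∨ x ∈ M} := by
  have hnd := C.nodup hP
  rw [Wk_append, Wk_append, Wk_append] at h
  obtain ⟨w1, w2, w3, w4⟩ := h
  have hne : v ∉ Y ∧ v ∉ Z ∧ v ≠ b ∧ w ∉ Y ∧ w ∉ Z ∧ w ≠ b ∧ a ≠ w ∧ w ∉ X ∧ w ∉ T ∧ a ≠ b := by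
    clear * - hnd; grind
  obtain ⟨n1, n2, n3, n4, n5, n6, n7, n8, n9, n10⟩ := hne
  have n11 := hvw.ne
  have n12 := hva.ne
  have e1 : Wk K.Adj s (X ++ a :: v :: b :: T) t := Wk_append.2 ⟨w1, hva.symm, hvb, w4⟩
  have e2 : w ∉ X ++ a :: v :: b :: T := by simp [n8, n7.symm, n11.symm, n6, n9]
  have e3 : 2 ≤ (X ++ a :: v :: b :: T).length := by simp; omega
  by_cases hY : Y = []
  · subst hY
    by_cases hZ : Z = []
    · subst hZ
      have hw : Lat K {x | x ∈ S ∨ x ∈ M} w := Hw.resolve_right fun h => h ⟨w2, K.adj_symm w3⟩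
      exact C.two hP s t (X ++ a :: v :: b :: T) a b [w] (pm fun z => by simp only [cA, cC, cN]; omega)
        e1 ⟨w2, w3⟩ (by simp) (by simp) hs ht (hst.len e3) (by simp) (by simp) n10
        (fun _ => Or.inr ⟨w, by simp, hvw⟩) (by simp [n11]) (absurd · e2) (fun _ => hw)
    · exact C.three hP s t (X ++ a :: v :: b :: T) a v [w] w b Z (pm fun z => by simp only [cA, cC, cN]; omega)
        e1 ⟨w2, hvw.symm⟩ w3 (by simp) (by simp) hZ hs ht (hst.len e3) (by simp) (by simp) n12.symm
        (by simp) (by simp) n6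
        (fun _ => Or.inr ⟨w, by simp, hvw⟩) (by simp [n11]) (absurd · n2)
        (absurd · e2) (fun _ => Or.inr (Wk_head w3 hZ)) (absurd · n5)
  · obtain ⟨y, hy, hyw⟩ := Wk_last w2 hY
    exact C.three hP s t (X ++ a :: v :: b :: T) v b (w :: Z) a w Y (pm fun z => by simp only [cA, cC, cN]; omega)
        e1 ⟨hvw, w3⟩ w2 (by simp) (by simp) hY hs ht (hst.len e3) (by simp) (by simp) n3
        (by simp) (by simp) n7
        (fun _ => Or.inr ⟨w, by simp, hvw⟩) (by simp [n11, n2]) (absurd · n1)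
        (absurd · e2) (fun _ => Or.inr ⟨y, hy, hyw.symm⟩) (absurd · n4)

/-- positions of two distinct members -/
theorem split2 (ha : a ∈ L) (hb : b ∈ L) (hab : a ≠ b) :
    (∃ X Y Z, L = X ++ a :: (Y ++ b :: Z)) ∨ (∃ X Y Z, L = X ++ b :: (Y ++ a :: Z)) := by
  obtain ⟨X, Y, rfl⟩ := List.append_of_mem ha
  simp only [List.mem_append, List.mem_cons, hab.symm, false_or] at hb
  rcases hb with hb | hb
  · obtain ⟨X1, X2, rfl⟩ := List.append_of_mem hb
    exact Or.inr ⟨X1, X2, Y, by simp⟩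
  · obtain ⟨X1, X2, rfl⟩ := List.append_of_mem hb
    exact Or.inl ⟨X, X1, X2, by simp⟩

theorem revP (hP : (v :: L).Perm M) : (v :: L.reverse).Perm M :=
  (pm fun z => by simp only [cC, cR]).trans hP

theorem Aw2' (C : Ctx K r S M v w) (hP : (v :: L).Perm M)
    (hvw : K.Adj v w) (hva : K.Adj v a) (hvb : K.Adj v b) (h : Wk K.Adj s L t)
    (haw : a ≠ w)
    (hs : s ∈ S) (ht : t ∈ S) (hb : b ∈ S) (hst : Ok r S s t 2) (hw : w ∈ L) (ha : a ∈ L)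
    (Hw : Lat K {x | x ∈ S ∨ x ∈ M} w ∨ ¬ (K.Adj a w ∧ K.Adj b w)) :
    NS K r {x | x ∈ S ∨ x ∈ M} := by
  rcases split2 hw ha haw.symm with ⟨X, Y, Z, rfl⟩ | ⟨X, Y, Z, rfl⟩
  · exact Aw2 C hP hvw hva hvb h hs ht hb hst Hw
  · have h := Wk_symm h
    have hP := revP hP
    simp only [List.reverse_append, List.reverse_cons, List.append_assoc, List.singleton_append, List.cons_append, List.nil_append] at h hP
    exact Aw2 C hP hvw hva hvb h ht hs hb hst.symm Hw

theorem Aw34 (C : Ctx K r S M v w) (hP : (v :: (X ++ a :: (Y ++ b :: Z))).Perm M)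
    (hvw : K.Adj v w) (hva : K.Adj v a) (hvb : K.Adj v b) (h : Wk K.Adj s (X ++ a :: (Y ++ b :: Z)) t)
    (haw : a ≠ w) (hbw : b ≠ w)
    (hs : s ∈ S) (ht : t ∈ S) (hst : Ok r S s t 2) (hw : w ∈ X ++ a :: (Y ++ b :: Z))
    (Hw : Lat K {x | x ∈ S ∨ x ∈ M} w ∨ ¬ (K.Adj a w ∧ K.Adj b w)) :
    NS K r {x | x ∈ S ∨ x ∈ M} := by
  simp only [List.mem_append, List.mem_cons, haw.symm, hbw.symm, false_or] at hw
  rcases hw with hw | hw | hw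
  · obtain ⟨X1, X2, rfl⟩ := List.append_of_mem hw
    have h := Wk_symm h
    have hP := revP hP
    simp only [List.reverse_append, List.reverse_cons, List.append_assoc, List.singleton_append, List.cons_append, List.nil_append] at h hP
    exact Aw3 C hP hvw hvb hva h ht hs hst.symm
  · obtain ⟨X1, X2, rfl⟩ := List.append_of_mem hw
    simp only [List.append_assoc, List.cons_append] at h hP
    exact Aw4 C hP hvw hva hvb h hs ht hst Hw
  · obtain ⟨X1, X2, rfl⟩ := List.append_of_mem hw
    exact Aw3 C hP hvw hva hvb h hs ht hst

theorem newAw {R' : V → V → Prop} (C : Ctx K r S M v w) (hP : (v :: L).Perm M)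
    (hR : ∀ x y, R' x y → K.Adj x y ∨ (x = a ∧ y = b) ∨ (x = b ∧ y = a))
    (hva : K.Adj v a) (hvb : K.Adj v b) (hvw : K.Adj v w) (hab : a ≠ b)
    (haw : a ≠ w) (hbw : b ≠ w)
    (hW : Wk R' s L t)
    (hs : s ∈ S) (ht : t ∈ S) (hst : Ok r S s t L.length) (hw : w ∈ L)
    (ha : a ∈ S ∨ a ∈ L) (hb : b ∈ S ∨ b ∈ L) (hnew : ¬ (a ∈ S ∧ b ∈ S))
    (Hw : Lat K {x | x ∈ S ∨ x ∈ M} w ∨ ¬ (K.Adj a w ∧ K.Adj b w)) :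
    NS K r {x | x ∈ S ∨ x ∈ M} := by
  have hnd := C.nodup hP
  have hd := C.disj hP
  have hst2 : Ok r S s t 2 := hst.len le_rfl
  have Hw' : Lat K {x | x ∈ S ∨ x ∈ M} w ∨ ¬ (K.Adj b w ∧ K.Adj a w) := by tauto
  rcases Wk_insert hR hva.symm hvb.symm hva hvb hW (List.nodup_cons.1 hnd).2
    (fun h => hd s (by simp [h]) hs) (fun h => hd t (by simp [h]) ht) (hst.imp_right fun h => h.2) with
    h' | ⟨X, Y, p, q, rfl, hX, hY, hpq, h5, h6⟩
  · by_cases haS : a ∈ S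
    · have hbS : b ∈ L := by tauto
      exact Aw2' C hP hvw hvb hva h' hbw hs ht haS hst2 hw hbS Hw'
    · have haL : a ∈ L := by tauto
      by_cases hbS : b ∈ S
      · exact Aw2' C hP hvw hva hvb h' haw hs ht hbS hst2 hw haL Hw
      · have hbL : b ∈ L := by tauto
        rcases split2 haL hbL hab with ⟨X, Y, Z, rfl⟩ | ⟨X, Y, Z, rfl⟩
        · exact Aw34 C hP hvw hva hvb h' haw hbw hs ht hst2 hw Hw
        · exact Aw34 C hP hvw hvb hva h' hbw haw hs ht hst2 hw Hw'
  · have hpw : p ≠ w := by rcases hpq with h | h <;> simp [h, haw, hbw]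
    have hqw : q ≠ w := by rcases hpq with h | h <;> simp [h, haw, hbw]
    rcases List.mem_append.1 hw with hw | hw
    · obtain ⟨X1, X2, rfl⟩ := List.append_of_mem hw
      have hne : X2 ≠ [] := by
        rintro rfl
        rcases hX with ⟨h, -⟩ | ⟨X', h⟩
        · simp at h
        · have := congrArg List.getLast? h
          simp at this
          exact hpw this.symm
      have h5 := Wk_symm h5
      have h6 := Wk_symm h6
      have hP := revP hP
      simp only [List.reverse_append, List.reverse_cons, List.append_assoc, List.singleton_append, List.cons_append, List.nil_append] at h5 hP
      exact Aw1 C hP hvw h6 h5 (by simpa using hne) ht hs hst2.symm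
    · obtain ⟨Y1, Y2, rfl⟩ := List.append_of_mem hw
      have hne : Y1 ≠ [] := by
        rintro rfl
        rcases hY with ⟨h, -⟩ | ⟨X', h⟩
        · simp at h
        · simp at h
          exact hqw h.1.symm
      exact Aw1 C hP hvw h5 h6 hne hs ht hst2
end
end Mond

namespace Mond
section
variable {V : Type u} {K : SimpleGraph V} {r a b c d v s t w : V} {S : Set V} {M L X Y Z T I R R' : List V}

theorem Ctx.swap (C : Ctx K r S M v w) : Ctx K r S M w v :=
  ⟨C.ns, C.nd, C.dis, fun x hx h1 h2 => C.lat x hx h2 h1⟩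

theorem swP (hP : (v :: w :: L).Perm M) : (w :: v :: L).Perm M :=
  (List.Perm.swap v w L).trans hP

theorem revP2 (hP : (v :: w :: L).Perm M) : (v :: w :: L.reverse).Perm M :=
  (pm fun z => by simp only [cC, cR]).trans hP

theorem chNe (C : Ctx K r S M v w) (hP : (v :: w :: L).Perm M) : v ∉ L ∧ w ∉ L ∧ v ∉ S ∧ w ∉ S := by
  have hnd := C.nodup hP
  have hd := C.disj hP
  have h1 := hd v (by simp)
  have h2 := hd w (by simp)
  clear * - hnd h1 h2
  grind

theorem Ch1b (C : Ctx K r S M v w) (hP : (v :: w :: (X ++ b :: (Y ++ d :: Z))).Perm M)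
    (hvw : K.Adj v w) (hva : K.Adj v a) (hvb : K.Adj v b) (hwa : K.Adj w a) (hwd : K.Adj w d)
    (h : Wk K.Adj s (X ++ b :: (Y ++ d :: Z)) t)
    (hs : s ∈ S) (ht : t ∈ S) (ha : a ∈ S) (hst : Ok r S s t 2) :
    NS K r {x | x ∈ S ∨ x ∈ M} := by
  have hd := C.disj hP
  obtain ⟨hvL, hwL, hvS, hwS⟩ := chNe C hP
  rw [Wk_append, Wk_append] at h
  obtain ⟨w1, w2, w3⟩ := h
  simp only [List.mem_append, List.mem_cons, not_or] at hvL hwL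
  have hbS : b ∉ S := hd _ (by simp)
  have hdS : d ∉ S := hd _ (by simp)
  have h1 : v ≠ a := hva.ne
  have h2 : b ≠ t := fun h => hbS (h ▸ ht)
  have h3 : s ≠ w := fun h => hwS (h ▸ hs)
  have h4 : s ≠ d := fun h => hdS (h ▸ hs)
  have h5 := hvw.ne
  by_cases hok : Ok r S s a 2
  · exact C.three hP s a (X ++ b :: [v]) v a [w] b t (Y ++ d :: Z) (pm fun z => by simp only [cA, cC, cN]; omega)
      (Wk_append.2 ⟨w1, hvb.symm, hva⟩) ⟨hvw, hwa⟩ (Wk_append.2 ⟨w2, w3⟩) (by simp) (by simp) (by simp)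
      hs ha (hok.len (by simp)) (by simp) (Or.inl ha) h1 (by simp) (by simp [ht]) h2
      (fun _ => Or.inr ⟨w, by simp, hvw⟩) (by simp [h5]) (by simp [hvL])
      (by simp [hwL, h5.symm]) (fun _ => Or.inr ⟨d, by simp, hwd⟩) (by simp [hwL])
  · obtain ⟨rfl, h0⟩ := not_ok hok le_rfl
    have hst' : s ≠ t := hst.resolve_right fun h => h0 h.1
    exact C.three hP s t (w :: d :: Z) s w [v] s d (X ++ b :: Y) (pm fun z => by simp only [cA, cC, cN]; omega)
      ⟨hwa.symm, hwd, w3⟩ ⟨hva.symm, hvw⟩ (Wk_append.2 ⟨w1, w2⟩) (by simp) (by simp) (by simp)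
      hs ht (Or.inl hst') (Or.inl hs) (by simp) h3 (by simp [hs]) (by simp) h4
      (by simp [hvL, h5]) (fun _ => Or.inr ⟨b, by simp, hvb⟩) (by simp [hvL])
      (fun _ => Or.inr ⟨v, by simp, hvw.symm⟩) (by simp [h5.symm]) (by simp [hwL])

theorem Ch1 (C : Ctx K r S M v w) (hP : (v :: w :: L).Perm M)
    (hvw : K.Adj v w) (hva : K.Adj v a) (hvb : K.Adj v b) (hwc : K.Adj w c) (hwd : K.Adj w d)
    (h : Wk K.Adj s L t)
    (hs : s ∈ S) (ht : t ∈ S) (ha : a ∈ S) (hc : c ∈ S) (hb : b ∈ L) (hd : d ∈ L) (hst : Ok r S s t 2)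
    (hne : s(a, b) ≠ s(c, d)) : NS K r {x | x ∈ S ∨ x ∈ M} := by
  by_cases hac : a = c
  · subst hac
    have hbd : b ≠ d := by rintro rfl; exact hne rfl
    rcases split2 hb hd hbd with ⟨X, Y, Z, rfl⟩ | ⟨X, Y, Z, rfl⟩
    · exact Ch1b C hP hvw hva hvb hwc hwd h hs ht ha hst
    · exact Ch1b C.swap (swP hP) hvw.symm hwc hwd hva hvb h hs ht ha hst
  · have hst' : s ≠ t := hst.resolve_right fun h => hac (by
      have h1 := h.1 ▸ ha
      have h2 := h.1 ▸ hc
      rw [Set.mem_singleton_iff] at h1 h2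
      rw [h1, h2])
    obtain ⟨hvL, hwL, hvS, hwS⟩ := chNe C hP
    exact C.two hP a c [v, w] s t L (pm fun z => by simp only [cA, cC, cN]; omega)
      ⟨hva.symm, hvw, hwc⟩ h (by simp) (List.ne_nil_of_mem hb) ha hc (Or.inl hac) (Or.inl hs) (Or.inl ht) hst'
      (fun _ => Or.inr ⟨b, hb, hvb⟩) (absurd · hvL) (fun _ => Or.inr ⟨d, hd, hwd⟩) (absurd · hwL)

theorem Ch2a (C : Ctx K r S M v w) (hP : (v :: w :: (X ++ c :: (Y ++ d :: Z))).Perm M)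
    (hvw : K.Adj v w) (hva : K.Adj v a) (hvb : K.Adj v b) (hwc : K.Adj w c) (hwd : K.Adj w d)
    (h : Wk K.Adj s (X ++ c :: (Y ++ d :: Z)) t)
    (hs : s ∈ S) (ht : t ∈ S) (ha : a ∈ S) (hst : Ok r S s t 2) (hb : b ∈ X ∨ b = c) :
    NS K r {x | x ∈ S ∨ x ∈ M} := by
  have hd := C.disj hP
  have hnd := C.nodup hP
  obtain ⟨hvL, hwL, hvS, hwS⟩ := chNe C hP
  rw [Wk_append, Wk_append] at h
  obtain ⟨w1, w2, w3⟩ := h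
  have hcS : c ∉ S := hd _ (by simp)
  have hdS : d ∉ S := hd _ (by simp)
  have h1 : s ≠ d := fun h => hdS (h ▸ hs)
  have h2 : c ≠ t := fun h => hcS (h ▸ ht)
  have h3 := hvb.ne
  have h4 := hvw.ne
  simp only [List.mem_append, List.mem_cons, not_or] at hvL hwL
  by_cases hok : Ok r S a t 2
  · exact C.two hP a t (v :: w :: d :: Z) s d (X ++ c :: Y) (pm fun z => by simp only [cA, cC, cN]; omega)
      ⟨hva.symm, hvw, hwd, w3⟩ (Wk_append.2 ⟨w1, w2⟩) (by simp) (by simp) ha ht (hok.len (by simp))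
      (Or.inl hs) (by simp) h1
      (fun _ => Or.inr ⟨b, by simp; tauto, hvb⟩) (by simp [hvL]) (fun _ => Or.inr ⟨c, by simp, hwc⟩) (by simp [hwL])
  · obtain ⟨rfl, h0⟩ := not_ok hok le_rfl
    have hst' : s ≠ a := hst.resolve_right fun h => h0 h.1
    rcases hb with hb | rfl
    · have hbc : b ≠ c := by clear * - hnd hb; grind
      obtain ⟨X1, X2, rfl⟩ := List.append_of_mem hb
      rw [Wk_append] at w1
      simp only [List.mem_append, List.mem_cons, not_or] at hvL hwL
      exact C.three hP s a (X1 ++ b :: [v]) b v (X2 ++ c :: [w]) c a (Y ++ d :: Z) (pm fun z => by simp only [cA, cC, cN]; omega)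
        (Wk_append.2 ⟨w1.1, hvb.symm, hva⟩) (Wk_append.2 ⟨w1.2, hwc.symm, hvw.symm⟩) (Wk_append.2 ⟨w2, w3⟩)
        (by simp) (by simp) (by simp) hs ht (Or.inl hst') (by simp) (by simp) h3.symm (by simp) (by simp [ht]) h2
        (fun _ => Or.inr ⟨w, by simp, hvw⟩) (by simp [hvL, h4]) (by simp [hvL])
        (by simp [hwL, h4.symm]) (fun _ => Or.inr ⟨d, by simp, hwd⟩) (by simp [hwL])
    · exact C.three hP s a (X ++ b :: [v]) b v [w] b a (Y ++ d :: Z) (pm fun z => by simp only [cA, cC, cN]; omega)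
        (Wk_append.2 ⟨w1, hvb.symm, hva⟩) ⟨hwc.symm, hvw.symm⟩ (Wk_append.2 ⟨w2, w3⟩)
        (by simp) (by simp) (by simp) hs ht (Or.inl hst') (by simp) (by simp) h3.symm (by simp) (by simp [ht]) h2
        (fun _ => Or.inr ⟨w, by simp, hvw⟩) (by simp [hvL, h4]) (by simp [hvL])
        (by simp [hwL, h4.symm]) (fun _ => Or.inr ⟨d, by simp, hwd⟩) (by simp [hwL])

theorem Ch2b (C : Ctx K r S M v w) (hP : (v :: w :: (X ++ c :: (Y ++ b :: (I ++ d :: Z)))).Perm M)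
    (hvw : K.Adj v w) (hva : K.Adj v a) (hvb : K.Adj v b) (hwc : K.Adj w c) (hwd : K.Adj w d)
    (h : Wk K.Adj s (X ++ c :: (Y ++ b :: (I ++ d :: Z))) t)
    (hs : s ∈ S) (ht : t ∈ S) (ha : a ∈ S) (hst : Ok r S s a 2) :
    NS K r {x | x ∈ S ∨ x ∈ M} := by
  have hd := C.disj hP
  obtain ⟨hvL, hwL, hvS, hwS⟩ := chNe C hP
  rw [Wk_append] at h
  obtain ⟨w1, w2⟩ := h
  have hcS : c ∉ S := hd _ (by simp)
  have h2 : c ≠ t := fun h => hcS (h ▸ ht)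
  simp only [List.mem_append, List.mem_cons, not_or] at hvL hwL
  exact C.two hP s a (X ++ c :: w :: [v]) c t (Y ++ b :: (I ++ d :: Z)) (pm fun z => by simp only [cA, cC, cN]; omega)
    (Wk_append.2 ⟨w1, hwc.symm, hvw.symm, hva⟩) w2 (by simp) (by simp) hs ha (hst.len (by simp))
    (by simp) (Or.inl ht) h2
    (fun _ => Or.inr ⟨b, by simp, hvb⟩) (by simp [hvL]) (fun _ => Or.inr ⟨d, by simp, hwd⟩) (by simp [hwL])

theorem Ch2c (C : Ctx K r S M v w) (hP : (v :: w :: (X ++ c :: (Y ++ d :: Z))).Perm M)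
    (hvw : K.Adj v w) (hva : K.Adj v a) (hvb : K.Adj v b) (hwc : K.Adj w c) (hwd : K.Adj w d)
    (h : Wk K.Adj s (X ++ c :: (Y ++ d :: Z)) t)
    (hs : s ∈ S) (ht : t ∈ S) (ha : a ∈ S) (hst : Ok r S s t 2) (hb : b ∈ X ++ c :: (Y ++ d :: Z)) :
    NS K r {x | x ∈ S ∨ x ∈ M} := by
  have h' := Wk_symm h
  have hP' := revP2 hP
  simp only [List.reverse_append, List.reverse_cons, List.append_assoc, List.singleton_append, List.cons_append, List.nil_append] at h' hP'
  simp only [List.mem_append, List.mem_cons] at hb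
  by_cases hb1 : b ∈ X ∨ b = c
  · exact Ch2a C hP hvw hva hvb hwc hwd h hs ht ha hst hb1
  by_cases hb2 : b ∈ Z ∨ b = d
  · exact Ch2a C hP' hvw hva hvb hwd hwc h' ht hs ha hst.symm (by simpa using hb2)
  have hb3 : b ∈ Y := by tauto
  obtain ⟨Y1, Y2, rfl⟩ := List.append_of_mem hb3
  simp only [List.reverse_append, List.reverse_cons, List.append_assoc, List.singleton_append, List.cons_append, List.nil_append] at h' hP' h hP
  by_cases hok : Ok r S s a 2
  · exact Ch2b C hP hvw hva hvb hwc hwd h hs ht ha hok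
  by_cases hok' : Ok r S t a 2
  · exact Ch2b C hP' hvw hva hvb hwd hwc h' ht hs ha hok'
  obtain ⟨rfl, h0⟩ := not_ok hok le_rfl
  obtain ⟨rfl, -⟩ := not_ok hok' le_rfl
  exact absurd hst hok

theorem Ch2 (C : Ctx K r S M v w) (hP : (v :: w :: L).Perm M)
    (hvw : K.Adj v w) (hva : K.Adj v a) (hvb : K.Adj v b) (hwc : K.Adj w c) (hwd : K.Adj w d)
    (hcd : c ≠ d) (h : Wk K.Adj s L t)
    (hs : s ∈ S) (ht : t ∈ S) (ha : a ∈ S) (hc : c ∈ L) (hb : b ∈ L) (hd : d ∈ L) (hst : Ok r S s t 2) :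
    NS K r {x | x ∈ S ∨ x ∈ M} := by
  rcases split2 hc hd hcd with ⟨X, Y, Z, rfl⟩ | ⟨X, Y, Z, rfl⟩
  · exact Ch2c C hP hvw hva hvb hwc hwd h hs ht ha hst hb
  · exact Ch2c C hP hvw hva hvb hwd hwc h hs ht ha hst hb

/-- relative order of two positions -/
theorem order (h : X ++ a :: R = Y ++ c :: R') :
    (a = c ∧ R = R') ∨ (∃ Z, R = Z ++ c :: R') ∨ (∃ Z, R' = Z ++ a :: R) := by
  rw [List.append_eq_append_iff] at h
  rcases h with ⟨Z, rfl, h⟩ | ⟨Z, rfl, h⟩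
  · cases Z with
    | nil => simp at h; exact Or.inl h
    | cons z Z => simp at h; exact Or.inr (Or.inl ⟨Z, h.2⟩)
  · cases Z with
    | nil => simp at h; exact Or.inl ⟨h.1.symm, h.2.symm⟩
    | cons z Z => simp at h; exact Or.inr (Or.inr ⟨Z, h.2⟩)

theorem Ch4a (C : Ctx K r S M v w) (hP : (v :: w :: (X ++ a :: (Y ++ b :: (Z ++ d :: T)))).Perm M)
    (hvw : K.Adj v w) (hva : K.Adj v a) (hvb : K.Adj v b) (hwa : K.Adj w a) (hwd : K.Adj w d)
    (h : Wk K.Adj s (X ++ a :: (Y ++ b :: (Z ++ d :: T))) t)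
    (hs : s ∈ S) (ht : t ∈ S) (hst : Ok r S s t 2) :
    NS K r {x | x ∈ S ∨ x ∈ M} := by
  obtain ⟨hvL, hwL, hvS, hwS⟩ := chNe C hP
  have hnd := C.nodup hP
  have had : a ≠ d := by clear * - hnd; grind
  rw [Wk_append, Wk_append, Wk_append] at h
  obtain ⟨w1, w2, w3, w4⟩ := h
  simp only [List.mem_append, List.mem_cons, not_or] at hvL hwL
  have h4 := hvw.ne
  exact C.three hP s t (X ++ a :: w :: d :: T) a w [v] a d (Y ++ b :: Z) (pm fun z => by simp only [cA, cC, cN]; omega)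
    (Wk_append.2 ⟨w1, hwa.symm, hwd, w4⟩) ⟨hva.symm, hvw⟩ (Wk_append.2 ⟨w2, w3⟩)
    (by simp) (by simp) (by simp) hs ht (hst.len (by simp; omega)) (by simp) (by simp) hwa.ne.symm
    (by simp) (by simp) had
    (by simp [hvL, h4]) (fun _ => Or.inr ⟨b, by simp, hvb⟩) (by simp [hvL])
    (fun _ => Or.inr ⟨v, by simp, hvw.symm⟩) (by simp [h4.symm]) (by simp [hwL])

theorem Ch4b (C : Ctx K r S M v w) (hP : (v :: w :: (X ++ a :: (I ++ d :: T))).Perm M)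
    (hvw : K.Adj v w) (hva : K.Adj v a) (hvb : K.Adj v b) (hwc : K.Adj w c) (hwd : K.Adj w d)
    (h : Wk K.Adj s (X ++ a :: (I ++ d :: T)) t) (hb : b ∈ I) (hc : c ∈ I)
    (hs : s ∈ S) (ht : t ∈ S) (hst : Ok r S s t 2) :
    NS K r {x | x ∈ S ∨ x ∈ M} := by
  obtain ⟨hvL, hwL, hvS, hwS⟩ := chNe C hP
  have hnd := C.nodup hP
  have had : a ≠ d := by clear * - hnd; grind
  rw [Wk_append, Wk_append] at h
  obtain ⟨w1, w2, w3⟩ := h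
  simp only [List.mem_append, List.mem_cons, not_or] at hvL hwL
  exact C.two hP s t (X ++ a :: v :: w :: d :: T) a d I (pm fun z => by simp only [cA, cC, cN]; omega)
    (Wk_append.2 ⟨w1, hva.symm, hvw, hwd, w3⟩) w2 (by simp) (List.ne_nil_of_mem hb) hs ht
    (hst.len (by simp; omega)) (by simp) (by simp) had
    (fun _ => Or.inr ⟨b, hb, hvb⟩) (by simp [hvL]) (fun _ => Or.inr ⟨c, hc, hwc⟩) (by simp [hwL])

theorem Ch4c (C : Ctx K r S M v w) (hP : (v :: w :: (X ++ a :: (Y ++ c :: (Z ++ b :: T)))).Perm M)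
    (hvw : K.Adj v w) (hva : K.Adj v a) (hvb : K.Adj v b) (hwc : K.Adj w c) (hwb : K.Adj w b)
    (h : Wk K.Adj s (X ++ a :: (Y ++ c :: (Z ++ b :: T))) t)
    (hs : s ∈ S) (ht : t ∈ S) (hst : Ok r S s t 2) :
    NS K r {x | x ∈ S ∨ x ∈ M} := by
  obtain ⟨hvL, hwL, hvS, hwS⟩ := chNe C hP
  have hnd := C.nodup hP
  have had : a ≠ b := by clear * - hnd; grind
  rw [Wk_append, Wk_append, Wk_append] at h
  obtain ⟨w1, w2, w3, w4⟩ := h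
  simp only [List.mem_append, List.mem_cons, not_or] at hvL hwL
  have h4 := hvw.ne
  exact C.three hP s t (X ++ a :: v :: b :: T) v b [w] a b (Y ++ c :: Z) (pm fun z => by simp only [cA, cC, cN]; omega)
    (Wk_append.2 ⟨w1, hva.symm, hvb, w4⟩) ⟨hvw, hwb⟩ (Wk_append.2 ⟨w2, w3⟩)
    (by simp) (by simp) (by simp) hs ht (hst.len (by simp; omega)) (by simp) (by simp) hvb.ne
    (by simp) (by simp) had
    (fun _ => Or.inr ⟨w, by simp, hvw⟩) (by simp [h4]) (by simp [hvL])
    (by simp [hwL, h4.symm]) (fun _ => Or.inr ⟨c, by simp, hwc⟩) (by simp [hwL])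

theorem Ch4d (C : Ctx K r S M v w) (hP : (v :: w :: (X ++ a :: (Y ++ c :: (Z ++ d :: (I ++ b :: T))))).Perm M)
    (hvw : K.Adj v w) (hva : K.Adj v a) (hvb : K.Adj v b) (hwc : K.Adj w c) (hwd : K.Adj w d)
    (h : Wk K.Adj s (X ++ a :: (Y ++ c :: (Z ++ d :: (I ++ b :: T)))) t)
    (hs : s ∈ S) (ht : t ∈ S) (hst : Ok r S s t 2) :
    NS K r {x | x ∈ S ∨ x ∈ M} := by
  obtain ⟨hvL, hwL, hvS, hwS⟩ := chNe C hP
  have hnd := C.nodup hP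
  have hcb : c ≠ b := by rintro rfl; simp [List.nodup_append, List.nodup_cons] at hnd
  rw [Wk_append, Wk_append, Wk_append, Wk_append] at h
  obtain ⟨w1, w2, w3, w4, w5⟩ := h
  simp only [List.mem_append, List.mem_cons, not_or] at hvL hwL
  have h4 := hvw.ne
  exact C.three hP s t (X ++ a :: v :: b :: T) a v (Y ++ c :: [w]) c b (Z ++ d :: I) (pm fun z => by simp only [cA, cC, cN]; omega)
    (Wk_append.2 ⟨w1, hva.symm, hvb, w5⟩) (Wk_append.2 ⟨w2, hwc.symm, hvw.symm⟩) (Wk_append.2 ⟨w3, w4⟩)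
    (by simp) (by simp) (by simp) hs ht (hst.len (by simp; omega)) (by simp) (by simp) hva.ne.symm
    (by simp) (by simp) hcb
    (fun _ => Or.inr ⟨w, by simp, hvw⟩) (by simp [h4, hvL]) (by simp [hvL])
    (by simp [hwL, h4.symm]) (fun _ => Or.inr ⟨d, by simp, hwd⟩) (by simp [hwL])

theorem Ch4lt (C : Ctx K r S M v w) (hP : (v :: w :: (X ++ a :: (Y ++ c :: R))).Perm M)
    (hvw : K.Adj v w) (hva : K.Adj v a) (hvb : K.Adj v b) (hwc : K.Adj w c) (hwd : K.Adj w d)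
    (h : Wk K.Adj s (X ++ a :: (Y ++ c :: R)) t) (hb : b ∈ Y ++ c :: R) (hd : d ∈ R)
    (hs : s ∈ S) (ht : t ∈ S) (hst : Ok r S s t 2) :
    NS K r {x | x ∈ S ∨ x ∈ M} := by
  obtain ⟨R1, R2, rfl⟩ := List.append_of_mem hd
  by_cases hb1 : b ∈ Y ++ c :: R1
  · exact Ch4b (I := Y ++ c :: R1) C (by simpa using hP) hvw hva hvb hwc hwd (by simpa using h) hb1 (by simp) hs ht hst
  by_cases hbd : b = d
  · subst hbd
    exact Ch4c C hP hvw hva hvb hwc hwd h hs ht hst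
  have : b ∈ R2 := by
    simp only [List.mem_append, List.mem_cons] at hb hb1
    tauto
  obtain ⟨R3, R4, rfl⟩ := List.append_of_mem this
  exact Ch4d C hP hvw hva hvb hwc hwd h hs ht hst

theorem Ch4o (C : Ctx K r S M v w) (hP : (v :: w :: L).Perm M)
    (hvw : K.Adj v w) (hva : K.Adj v a) (hvb : K.Adj v b) (hwc : K.Adj w c) (hwd : K.Adj w d)
    (h : Wk K.Adj s L t) (h1 : L = X ++ a :: R) (hb : b ∈ R) (h2 : L = Y ++ c :: R') (hd : d ∈ R')
    (hs : s ∈ S) (ht : t ∈ S) (hst : Ok r S s t 2) (hne : s(a, b) ≠ s(c, d)) :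
    NS K r {x | x ∈ S ∨ x ∈ M} := by
  rcases order (h1.symm.trans h2) with ⟨rfl, rfl⟩ | ⟨Z, rfl⟩ | ⟨Z, rfl⟩
  · have hbd : b ≠ d := by rintro rfl; exact hne rfl
    rcases split2 hb hd hbd with ⟨P, Q, Z, rfl⟩ | ⟨P, Q, Z, rfl⟩ <;> subst h1
    · exact Ch4a C hP hvw hva hvb hwc hwd h hs ht hst
    · exact Ch4a C.swap (swP hP) hvw.symm hwc hwd hva hvb h hs ht hst
  · subst h1
    exact Ch4lt C hP hvw hva hvb hwc hwd h hb hd hs ht hst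
  · subst h2
    exact Ch4lt C.swap (swP hP) hvw.symm hwc hwd hva hvb h hd hb hs ht hst

theorem split1 (ha : a ∈ L) (hb : b ∈ L) (hab : a ≠ b) :
    (∃ X R, L = X ++ a :: R ∧ b ∈ R) ∨ (∃ X R, L = X ++ b :: R ∧ a ∈ R) := by
  rcases split2 ha hb hab with ⟨X, Y, Z, rfl⟩ | ⟨X, Y, Z, rfl⟩
  · exact Or.inl ⟨X, _, rfl, by simp⟩
  · exact Or.inr ⟨X, _, rfl, by simp⟩

theorem chords (C : Ctx K r S M v w) (hP : (v :: w :: L).Perm M)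
    (hvw : K.Adj v w) (hva : K.Adj v a) (hvb : K.Adj v b) (hwc : K.Adj w c) (hwd : K.Adj w d)
    (h : Wk K.Adj s L t) (hab : a ≠ b) (hcd : c ≠ d)
    (ha : a ∈ S ∨ a ∈ L) (hb : b ∈ S ∨ b ∈ L) (hc : c ∈ S ∨ c ∈ L) (hd : d ∈ S ∨ d ∈ L)
    (hn1 : ¬ (a ∈ S ∧ b ∈ S)) (hn2 : ¬ (c ∈ S ∧ d ∈ S))
    (hs : s ∈ S) (ht : t ∈ S) (hst : Ok r S s t 2) (hne : s(a, b) ≠ s(c, d)) :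
    NS K r {x | x ∈ S ∨ x ∈ M} := by
  have ne2 : s(b, a) ≠ s(c, d) := by rwa [Sym2.eq_swap]
  have ne3 : s(a, b) ≠ s(d, c) := by rwa [Sym2.eq_swap (a := d)]
  have ne4 : s(b, a) ≠ s(d, c) := by rwa [Sym2.eq_swap (a := d)]
  by_cases haS : a ∈ S
  · have hbL : b ∈ L := hb.resolve_left fun h => hn1 ⟨haS, h⟩
    by_cases hcS : c ∈ S
    · exact Ch1 C hP hvw hva hvb hwc hwd h hs ht haS hcS hbL (hd.resolve_left fun h => hn2 ⟨hcS, h⟩) hst hne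
    have hcL : c ∈ L := hc.resolve_left hcS
    by_cases hdS : d ∈ S
    · exact Ch1 C hP hvw hva hvb hwd hwc h hs ht haS hdS hbL hcL hst ne3
    exact Ch2 C hP hvw hva hvb hwc hwd hcd h hs ht haS hcL hbL (hd.resolve_left hdS) hst
  have haL : a ∈ L := ha.resolve_left haS
  by_cases hbS : b ∈ S
  · by_cases hcS : c ∈ S
    · exact Ch1 C hP hvw hvb hva hwc hwd h hs ht hbS hcS haL (hd.resolve_left fun h => hn2 ⟨hcS, h⟩) hst ne2
    have hcL : c ∈ L := hc.resolve_left hcS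
    by_cases hdS : d ∈ S
    · exact Ch1 C hP hvw hvb hva hwd hwc h hs ht hbS hdS haL hcL hst ne4
    exact Ch2 C hP hvw hvb hva hwc hwd hcd h hs ht hbS hcL haL (hd.resolve_left hdS) hst
  have hbL : b ∈ L := hb.resolve_left hbS
  by_cases hcS : c ∈ S
  · exact Ch2 C.swap (swP hP) hvw.symm hwc hwd hva hvb hab h hs ht hcS haL (hd.resolve_left fun h => hn2 ⟨hcS, h⟩) hbL hst
  have hcL : c ∈ L := hc.resolve_left hcS
  by_cases hdS : d ∈ S
  · exact Ch2 C.swap (swP hP) hvw.symm hwd hwc hva hvb hab h hs ht hdS haL hcL hbL hst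
  have hdL : d ∈ L := hd.resolve_left hdS
  rcases split1 haL hbL hab with ⟨X, R, h1, h2⟩ | ⟨X, R, h1, h2⟩ <;>
  rcases split1 hcL hdL hcd with ⟨X', R', h3, h4⟩ | ⟨X', R', h3, h4⟩
  · exact Ch4o C hP hvw hva hvb hwc hwd h h1 h2 h3 h4 hs ht hst hne
  · exact Ch4o C hP hvw hva hvb hwd hwc h h1 h2 h3 h4 hs ht hst ne3
  · exact Ch4o C hP hvw hvb hva hwc hwd h h1 h2 h3 h4 hs ht hst ne2
  · exact Ch4o C hP hvw hvb hva hwd hwc h h1 h2 h3 h4 hs ht hst ne4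
end
end Mond

namespace Mond
section
variable {V : Type u} {K H : SimpleGraph V} {r a b c d v s t w : V} {S : Set V} {M L X Y Z T I R R' : List V}

theorem newAl {R' : V → V → Prop} (C : Ctx K r S M v v) (hP : (v :: L).Perm M)
    (hR : ∀ x y, R' x y → K.Adj x y ∨ (x = a ∧ y = b) ∨ (x = b ∧ y = a))
    (hva : K.Adj v a) (hvb : K.Adj v b) (hab : a ≠ b)
    (hW : Wk R' s L t) (hne : L ≠ [])
    (hs : s ∈ S) (ht : t ∈ S) (hst : Ok r S s t L.length)
    (ha : a ∈ S ∨ a ∈ L) (hb : b ∈ S ∨ b ∈ L)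
    (hv : Lat K {x | x ∈ S ∨ x ∈ M} v) :
    NS K r {x | x ∈ S ∨ x ∈ M} := by
  have hnd := C.nodup hP
  have hd := C.disj hP
  rcases Wk_insert hR hva.symm hvb.symm hva hvb hW (List.nodup_cons.1 hnd).2
    (fun h => hd s (by simp [h]) hs) (fun h => hd t (by simp [h]) ht) (hst.imp_right fun h => h.2) with
    h' | ⟨X, Y, p, q, rfl, hX, hY, hpq, h5, h6⟩
  · exact C.two hP s t L a b [v] (pm fun z => by simp only [cA, cC, cN]; omega)
      h' ⟨hva.symm, hvb⟩ hne (by simp) hs ht hst ha hb hab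
      (fun _ => Or.inl hv) (fun _ => hv) (fun _ => Or.inl hv) (fun _ => hv)
  · exact C.one hP s t (X ++ v :: Y) (pm fun z => by simp only [cA, cC, cN]; omega)
      (Wk_append.2 ⟨h5, h6⟩) (by simp) hs ht (hst.imp_right fun h => ⟨h.1, by
        have := h.2; simp at this ⊢; omega⟩) (fun _ => hv) (fun _ => hv)

/-- `S` together with `v` as soon as both `a`, `b` are present. -/
def F1 (a b v : V) (S : Set V) : Set V := {x | x ∈ S ∨ (x = v ∧ a ∈ S ∧ b ∈ S)}

theorem EVind (hab : a ≠ b) (hwa : w ≠ a) (hwb : w ≠ b) (hrv : r ≠ v) (hav : a ≠ v) (hbv : b ≠ v)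
    (hwv : w ≠ v)
    (hH : ∀ x, ¬ H.Adj v x)
    (hK : ∀ x y, x ≠ v → y ≠ v → H.Adj x y → ¬ (x = a ∧ y = b) → ¬ (x = b ∧ y = a) → K.Adj x y)
    (hva : K.Adj v a) (hvb : K.Adj v b) (hvw : K.Adj v w)
    (h : NS H r S) : v ∉ S ∧ NS K r (F1 a b v S) := by
  have hH' : ∀ x y, H.Adj x y → x ≠ v ∧ y ≠ v := fun x y h =>
    ⟨fun e => hH y (e ▸ h), fun e => hH x (e ▸ h.symm)⟩
  have hK' : ∀ x y, H.Adj x y → K.Adj x y ∨ (x = a ∧ y = b) ∨ (x = b ∧ y = a) := by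
    intro x y h
    by_cases h1 : x = a ∧ y = b
    · exact Or.inr (Or.inl h1)
    by_cases h2 : x = b ∧ y = a
    · exact Or.inr (Or.inr h2)
    exact Or.inl (hK x y (hH' _ _ h).1 (hH' _ _ h).2 h h1 h2)
  induction h with
  | base =>
    refine ⟨fun h => hrv (by simpa using h.symm), NS.base.cast fun x => ?_⟩
    constructor
    · rintro (h | ⟨-, h1, h2⟩)
      · exact h
      · exact absurd (by simp at h1 h2; rw [h1, h2]) hab
    · exact Or.inl
  | @step' S s t L hS hW hne hnd hL hs ht hst hl ih =>
    obtain ⟨hvS, ih⟩ := ih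
    have hvL : v ∉ L := fun h => by
      obtain ⟨y, h1, -⟩ := hl v h
      exact hH _ h1
    have hvT : v ∉ {x | x ∈ S ∨ x ∈ L} := fun h => h.elim hvS hvL
    refine ⟨hvT, ?_⟩
    have hsr : S = {r} → ¬ (a ∈ S ∧ b ∈ S) := by
      rintro rfl ⟨h1, h2⟩
      exact hab (by simp at h1 h2; rw [h1, h2])
    have lat : ∀ x ∈ L, Lat K (F1 a b v {x | x ∈ S ∨ x ∈ L}) x := by
      intro x hx
      obtain ⟨y, h1, h2, h3⟩ := hl x hx
      have hyF : y ∉ F1 a b v {x | x ∈ S ∨ x ∈ L} := by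
        rintro ((h | h) | ⟨h, -⟩)
        · exact h2 h
        · exact h3 h
        · exact (hH' _ _ h1).2 h
      have hvF : y = a ∨ y = b → v ∉ F1 a b v {x | x ∈ S ∨ x ∈ L} := by
        rintro hy (h | ⟨-, h4, h5⟩)
        · exact hvT h
        · rcases hy with rfl | rfl
          · exact h4.elim h2 h3
          · exact h5.elim h2 h3
      rcases hK' _ _ h1 with h | ⟨rfl, rfl⟩ | ⟨rfl, rfl⟩
      · exact ⟨y, h, hyF⟩
      · exact ⟨v, hva.symm, hvF (Or.inr rfl)⟩
      · exact ⟨v, hvb.symm, hvF (Or.inl rfl)⟩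
    have hsF : s ∈ F1 a b v S := Or.inl hs
    have htF : t ∈ F1 a b v S := Or.inl ht
    by_cases hnew : (a ∈ S ∨ a ∈ L) ∧ (b ∈ S ∨ b ∈ L) ∧ ¬ (a ∈ S ∧ b ∈ S)
    · obtain ⟨ha, hb, hn⟩ := hnew
      have hF : F1 a b v S = S := by
        ext x
        exact ⟨fun h => h.elim id fun h => absurd h.2 hn, Or.inl⟩
      have hFT : F1 a b v {x | x ∈ S ∨ x ∈ L} = {x | x ∈ S ∨ x ∈ v :: L} := by
        ext x
        simp only [F1, Set.mem_ofPred_eq, List.mem_cons, ha, hb, and_true]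
        clear * -
        tauto
      rw [hF] at ih
      rw [hFT] at lat ⊢
      have C : ∀ w, Ctx K r S (v :: L) v w := fun w => by
        refine ⟨ih, List.nodup_cons.2 ⟨hvL, hnd⟩, ?_, ?_⟩
        · intro x hx
          rcases List.mem_cons.1 hx with rfl | hx
          · exact hvS
          · exact hL _ hx
        · intro x hx h1 h2
          exact lat x ((List.mem_cons.1 hx).resolve_left h1)
      by_cases hwS : w ∈ S
      · exact newA (C v) (List.Perm.refl _) hK' hva hvb hvw hab hwa hwb hW hne hs ht hst hwS ha hb hn
      by_cases hwL : w ∈ L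
      · exact newAw (C w) (List.Perm.refl _) hK' hva hvb hvw hab hwa.symm hwb.symm hW hs ht hst hwL ha hb hn
          (Or.inl (lat w hwL))
      · refine newAl (C v) (List.Perm.refl _) hK' hva hvb hab hW hne hs ht hst ha hb ⟨w, hvw, ?_⟩
        rintro (h | h)
        · exact hwS h
        · exact (List.mem_cons.1 h).elim hwv hwL
    · have hnew' : (a ∈ S ∨ a ∈ L) → (b ∈ S ∨ b ∈ L) → a ∈ S ∧ b ∈ S := fun h1 h2 =>
        by_contra fun h3 => hnew ⟨h1, h2, h3⟩
      refine ih.step s t L _ ?_ (Wk_mono' hW hne ?_) hne hnd ?_ hsF htF ?_ lat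
      · intro x
        simp only [F1, Set.mem_ofPred_eq]
        clear * - hnew'
        tauto
      · intro x y hx hy hxy h
        have hx' : x ∈ S ∨ x ∈ L := hx.imp_left fun (h : x = s) => h ▸ hs
        have hy' : y ∈ S ∨ y ∈ L := hy.imp_left fun (h : y = t) => h ▸ ht
        rcases hK' _ _ h with h | ⟨rfl, rfl⟩ | ⟨rfl, rfl⟩
        · exact h
        · have := hnew' hx' hy'
          exact absurd hxy (not_or.2 ⟨fun h => hL _ h this.1, fun h => hL _ h this.2⟩)
        · have := hnew' hy' hx'
          exact absurd hxy (not_or.2 ⟨fun h => hL _ h this.2, fun h => hL _ h this.1⟩)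
      · rintro x hx (h | ⟨rfl, -⟩)
        · exact hL _ hx h
        · exact hvL hx
      · refine hst.imp_right fun h => ⟨?_, h.2⟩
        rw [← h.1]
        ext x
        exact ⟨fun h' => h'.elim id fun h' => absurd h'.2 (hsr h.1), Or.inl⟩
end
end Mond

namespace Mond
section
variable {V : Type u} {K H : SimpleGraph V} {r a b c d v s t w : V} {S : Set V} {M L X Y Z T I R R' : List V}

/-- `S` together with `v` as soon as `a`, `b` are present and `w` as soon as `c`, `d` are. -/
def F2 (a b v c d w : V) (S : Set V) : Set V :=
  {x | x ∈ S ∨ (x = v ∧ a ∈ S ∧ b ∈ S) ∨ (x = w ∧ c ∈ S ∧ d ∈ S)}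

theorem F2_swap : F2 a b v c d w S = F2 c d w a b v S := by
  ext x
  simp only [F2, Set.mem_ofPred_eq]
  clear * -
  tauto

theorem F2_r (hab : a ≠ b) (hcd : c ≠ d) : F2 a b v c d w {r} = {r} := by
  ext x
  simp only [F2, Set.mem_ofPred_eq, Set.mem_singleton_iff]
  constructor
  · rintro (h | ⟨-, h1, h2⟩ | ⟨-, h1, h2⟩)
    · exact h
    · exact absurd (h1.trans h2.symm) hab
    · exact absurd (h1.trans h2.symm) hcd
  · exact Or.inl

theorem mem_ins {x y : V} (h : x ∈ X ++ Y) : x ∈ X ++ y :: Y := by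
  rcases List.mem_append.1 h with h | h <;> simp [h]

theorem EEA (hab : a ≠ b) (hcd : c ≠ d)
    (haw : a ≠ w) (hbw : b ≠ w) 
    (hvw : K.Adj v w) (hva : K.Adj v a) (hvb : K.Adj v b)
    (hK' : ∀ x y, H.Adj x y → K.Adj x y ∨ ((x = a ∧ y = b) ∨ (x = b ∧ y = a)) ∨
      ((x = c ∧ y = d) ∨ (x = d ∧ y = c)))
    (ih : NS K r (F2 a b v c d w S)) (hW : Wk H.Adj s L t) (hne : L ≠ []) (hnd : L.Nodup)
    (hL : ∀ x ∈ L, x ∉ S) (hs : s ∈ S) (ht : t ∈ S) (hst : s ≠ t ∨ (S = {r} ∧ 2 ≤ L.length))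
    (lat : ∀ x ∈ L, Lat K (F2 a b v c d w {x | x ∈ S ∨ x ∈ L}) x)
    (hvS : v ∉ S) (hvL : v ∉ L) (hwS : w ∉ S) (hwL : w ∉ L)
    (ha : a ∈ S ∨ a ∈ L) (hb : b ∈ S ∨ b ∈ L) (hn : ¬ (a ∈ S ∧ b ∈ S))
    (hC : (c ∈ S ∨ c ∈ L) → (d ∈ S ∨ d ∈ L) → c ∈ S ∧ d ∈ S) :
    NS K r (F2 a b v c d w {x | x ∈ S ∨ x ∈ L}) := by
  set S' := F2 a b v c d w S with hS'
  have hv' : v ≠ w := hvw.ne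
  have hSS : ∀ x, x ∈ S' → x ≠ w → x ∈ S := by
    rintro x (h | h | h) hx
    · exact h
    · exact absurd h.2 hn
    · exact absurd h.1 hx
  have hF : F2 a b v c d w {x | x ∈ S ∨ x ∈ L} = {x | x ∈ S' ∨ x ∈ v :: L} := by
    ext x
    simp only [hS', F2, Set.mem_ofPred_eq, List.mem_cons, ha, hb, and_true]
    clear * - hn hC
    tauto
  rw [hF] at lat ⊢
  have hvS' : v ∉ S' := fun h => hvS (hSS _ h hv')
  have hLS' : ∀ x ∈ L, x ∉ S' := fun x hx h => hL x hx (hSS _ h fun e => hwL (e ▸ hx))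
  have C : Ctx K r S' (v :: L) v v := by
    refine ⟨ih, List.nodup_cons.2 ⟨hvL, hnd⟩, ?_, ?_⟩
    · intro x hx
      rcases List.mem_cons.1 hx with rfl | hx
      · exact hvS'
      · exact hLS' _ hx
    · intro x hx h1 h2
      exact lat x ((List.mem_cons.1 hx).resolve_left h1)
  have hW' : Wk (fun x y => K.Adj x y ∨ (x = a ∧ y = b) ∨ (x = b ∧ y = a)) s L t := by
    refine Wk_mono' hW hne fun x y hx hy hxy h => ?_
    have hx' : x ∈ S ∨ x ∈ L := hx.imp_left fun (h : x = s) => h ▸ hs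
    have hy' : y ∈ S ∨ y ∈ L := hy.imp_left fun (h : y = t) => h ▸ ht
    rcases hK' _ _ h with h | h | ⟨rfl, rfl⟩ | ⟨rfl, rfl⟩
    · exact Or.inl h
    · exact Or.inr h
    · have := hC hx' hy'
      exact absurd hxy (not_or.2 ⟨fun h => hL _ h this.1, fun h => hL _ h this.2⟩)
    · have := hC hy' hx'
      exact absurd hxy (not_or.2 ⟨fun h => hL _ h this.2, fun h => hL _ h this.1⟩)
  have hst' : Ok r S' s t L.length := hst.imp_right fun h => ⟨by rw [hS', h.1, F2_r hab hcd], h.2⟩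
  have hsub : ∀ x, x ∈ S → x ∈ S' := fun x h => Or.inl h
  have hn' : ¬ (a ∈ S' ∧ b ∈ S') := fun h => hn ⟨hSS _ h.1 haw, hSS _ h.2 hbw⟩
  by_cases hw : w ∈ S'
  · exact newA C (List.Perm.refl _) (fun x y h => h) hva hvb hvw hab haw.symm hbw.symm hW' hne (hsub _ hs) (hsub _ ht) hst' hw
      (ha.imp_left (hsub _)) (hb.imp_left (hsub _)) hn'
  · refine newAl C (List.Perm.refl _) (fun x y h => h) hva hvb hab hW' hne (hsub _ hs) (hsub _ ht) hst'
      (ha.imp_left (hsub _)) (hb.imp_left (hsub _)) ⟨w, hvw, ?_⟩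
    rintro (h | h)
    · exact hw h
    · exact (List.mem_cons.1 h).elim hv'.symm hwL

theorem EEind (hab : a ≠ b) (hcd : c ≠ d) (hne' : s(a, b) ≠ s(c, d)) (hrv : r ≠ v) (hrw : r ≠ w)
    (hav : a ≠ v) (hbv : b ≠ v) (hcv : c ≠ v) (hdv : d ≠ v)
    (haw : a ≠ w) (hbw : b ≠ w) (hcw : c ≠ w) (hdw : d ≠ w)
    (hHv : ∀ x, ¬ H.Adj v x) (hHw : ∀ x, ¬ H.Adj w x)
    (hvw : K.Adj v w) (hva : K.Adj v a) (hvb : K.Adj v b) (hwc : K.Adj w c) (hwd : K.Adj w d)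
    (hNv : ∀ x, K.Adj v x → x = a ∨ x = b ∨ x = w) (hNw : ∀ x, K.Adj w x → x = c ∨ x = d ∨ x = v)
    (hK' : ∀ x y, H.Adj x y → K.Adj x y ∨ ((x = a ∧ y = b) ∨ (x = b ∧ y = a)) ∨
      ((x = c ∧ y = d) ∨ (x = d ∧ y = c)))
    (h : NS H r S) : v ∉ S ∧ w ∉ S ∧ NS K r (F2 a b v c d w S) := by
  have hv' : v ≠ w := hvw.ne
  have hH' : ∀ x y, H.Adj x y → y ≠ v ∧ y ≠ w := fun x y h =>
    ⟨fun e => hHv x (e ▸ h.symm), fun e => hHw x (e ▸ h.symm)⟩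
  have hK'' : ∀ x y, H.Adj x y → K.Adj x y ∨ ((x = c ∧ y = d) ∨ (x = d ∧ y = c)) ∨
      ((x = a ∧ y = b) ∨ (x = b ∧ y = a)) := fun x y h => (hK' x y h).imp_right Or.symm
  induction h with
  | base =>
    refine ⟨fun h => hrv (by simpa using h.symm), fun h => hrw (by simpa using h.symm), ?_⟩
    rw [F2_r hab hcd]
    exact NS.base
  | @step' S s t L hS hW hne hnd hL hs ht hst hl ih =>
    obtain ⟨hvS, hwS, ih⟩ := ih
    have hvL : v ∉ L := fun h => by
      obtain ⟨y, h1, -⟩ := hl v h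
      exact hHv _ h1
    have hwL : w ∉ L := fun h => by
      obtain ⟨y, h1, -⟩ := hl w h
      exact hHw _ h1
    have hvT : v ∉ {x | x ∈ S ∨ x ∈ L} := fun h => h.elim hvS hvL
    have hwT : w ∉ {x | x ∈ S ∨ x ∈ L} := fun h => h.elim hwS hwL
    refine ⟨hvT, hwT, ?_⟩
    have lat : ∀ x ∈ L, Lat K (F2 a b v c d w {x | x ∈ S ∨ x ∈ L}) x := by
      intro x hx
      obtain ⟨y, h1, h2, h3⟩ := hl x hx
      have hyT : y ∉ {x | x ∈ S ∨ x ∈ L} := fun h => h.elim h2 h3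
      have hyF : y ∉ F2 a b v c d w {x | x ∈ S ∨ x ∈ L} := by
        rintro (h | ⟨h, -⟩ | ⟨h, -⟩)
        · exact hyT h
        · exact (hH' _ _ h1).1 h
        · exact (hH' _ _ h1).2 h
      have hvF : y = a ∨ y = b → v ∉ F2 a b v c d w {x | x ∈ S ∨ x ∈ L} := by
        rintro hy (h | ⟨-, h4, h5⟩ | ⟨h, -⟩)
        · exact hvT h
        · rcases hy with rfl | rfl
          · exact hyT h4
          · exact hyT h5
        · exact hv' h
      have hwF : y = c ∨ y = d → w ∉ F2 a b v c d w {x | x ∈ S ∨ x ∈ L} := by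
        rintro hy (h | ⟨h, -⟩ | ⟨-, h4, h5⟩)
        · exact hwT h
        · exact hv' h.symm
        · rcases hy with rfl | rfl
          · exact hyT h4
          · exact hyT h5
      rcases hK' _ _ h1 with h | (⟨rfl, rfl⟩ | ⟨rfl, rfl⟩) | (⟨rfl, rfl⟩ | ⟨rfl, rfl⟩)
      · exact ⟨y, h, hyF⟩
      · exact ⟨v, hva.symm, hvF (Or.inr rfl)⟩
      · exact ⟨v, hvb.symm, hvF (Or.inl rfl)⟩
      · exact ⟨w, hwc.symm, hwF (Or.inr rfl)⟩
      · exact ⟨w, hwd.symm, hwF (Or.inl rfl)⟩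
    by_cases hnA : (a ∈ S ∨ a ∈ L) ∧ (b ∈ S ∨ b ∈ L) ∧ ¬ (a ∈ S ∧ b ∈ S)
    · obtain ⟨ha, hb, hn⟩ := hnA
      by_cases hnC : (c ∈ S ∨ c ∈ L) ∧ (d ∈ S ∨ d ∈ L) ∧ ¬ (c ∈ S ∧ d ∈ S)
      · obtain ⟨hc, hd, hn2⟩ := hnC
        have hF : F2 a b v c d w S = S := by
          ext x
          exact ⟨fun h => h.elim id fun h => h.elim (fun h => absurd h.2 hn) (fun h => absurd h.2 hn2), Or.inl⟩
        have hFT : F2 a b v c d w {x | x ∈ S ∨ x ∈ L} = {x | x ∈ S ∨ x ∈ v :: w :: L} := by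
          ext x
          simp only [F2, Set.mem_ofPred_eq, List.mem_cons, ha, hb, hc, hd, and_true]
          clear * -
          tauto
        rw [hF] at ih
        rw [hFT] at lat ⊢
        have C : Ctx K r S (v :: w :: L) v w := by
          refine ⟨ih, ?_, ?_, ?_⟩
          · simp [hvL, hwL, hv', hnd]
          · intro x hx
            rcases List.mem_cons.1 hx with rfl | hx
            · exact hvS
            rcases List.mem_cons.1 hx with rfl | hx
            · exact hwS
            · exact hL _ hx
          · intro x hx h1 h2
            exact lat x ((List.mem_cons.1 ((List.mem_cons.1 hx).resolve_left h1)).resolve_left h2)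
        have hsL : s ∉ L := fun h => hL _ h hs
        have htL : t ∉ L := fun h => hL _ h ht
        have hst2 : s ≠ t ∨ 2 ≤ L.length := hst.imp_right fun h => h.2
        rcases Wk_insert (R := fun x y => K.Adj x y ∨ (x = a ∧ y = b) ∨ (x = b ∧ y = a)) (a := c) (b := d) (v := w)
          (fun x y h => or_assoc.2 (hK' x y h)) (Or.inl hwc.symm) (Or.inl hwd.symm)
          (Or.inl hwc) (Or.inl hwd) hW hnd hsL htL hst2 with h' | ⟨X, Y, p, q, rfl, -, -, -, h5, h6⟩
        · rcases Wk_insert (R := K.Adj) (a := a) (b := b) (v := v) (fun x y h => h) hva.symm hvb.symm hva hvb h' hnd hsL htL hst2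
            with h' | ⟨X, Y, p, q, rfl, -, -, -, h5, h6⟩
          · exact chords C (List.Perm.refl _) hvw hva hvb hwc hwd h' hab hcd ha hb hc hd hn hn2 hs ht
              (Ok.len hst le_rfl) hne'
          · refine newAw (L := X ++ v :: Y) (R' := K.Adj) (a := c) (b := d) C.swap (pm fun z => by simp only [cA, cC, cN]; omega) (fun x y h => Or.inl h)
              hwc hwd hvw.symm hcd hcv hdv (Wk_append.2 ⟨h5, h6⟩) hs ht (hst.imp_right fun h => ⟨h.1, ?_⟩)
              (by simp) (hc.imp_right ?_) (hd.imp_right ?_) hn2 (Or.inr ?_)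
            · have := h.2; simp at this ⊢; omega
            · exact mem_ins
            · exact mem_ins
            · rintro ⟨h1, h2⟩
              have h1 := hNv _ h1.symm
              have h2 := hNv _ h2.symm
              apply hne'
              rw [Sym2.eq_iff]
              clear * - h1 h2 hcw hdw hcd
              grind
        · refine newAw (L := X ++ w :: Y) (a := a) (b := b) C (pm fun z => by simp only [cA, cC, cN]; omega) (fun x y h => h)
              hva hvb hvw hab haw hbw (Wk_append.2 ⟨h5, h6⟩) hs ht (hst.imp_right fun h => ⟨h.1, ?_⟩)
              (by simp) (ha.imp_right ?_) (hb.imp_right ?_) hn (Or.inr ?_)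
          · have := h.2; simp at this ⊢; omega
          · exact mem_ins
          · exact mem_ins
          · rintro ⟨h1, h2⟩
            have h1 := hNw _ h1.symm
            have h2 := hNw _ h2.symm
            apply hne'
            rw [Sym2.eq_iff]
            clear * - h1 h2 hav hbv hab
            grind
      · exact EEA hab hcd haw hbw hvw hva hvb hK' ih hW hne hnd hL hs ht hst lat hvS hvL hwS hwL ha hb hn
          fun h1 h2 => by_contra fun h3 => hnC ⟨h1, h2, h3⟩
    · have hA : (a ∈ S ∨ a ∈ L) → (b ∈ S ∨ b ∈ L) → a ∈ S ∧ b ∈ S := fun h1 h2 =>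
        by_contra fun h3 => hnA ⟨h1, h2, h3⟩
      by_cases hnC : (c ∈ S ∨ c ∈ L) ∧ (d ∈ S ∨ d ∈ L) ∧ ¬ (c ∈ S ∧ d ∈ S)
      · obtain ⟨hc, hd, hn2⟩ := hnC
        rw [F2_swap] at ih lat ⊢
        exact EEA hcd hab hcv hdv hvw.symm hwc hwd hK'' ih hW hne hnd hL hs ht hst lat hwS hwL hvS hvL hc hd hn2 hA
      have hC : (c ∈ S ∨ c ∈ L) → (d ∈ S ∨ d ∈ L) → c ∈ S ∧ d ∈ S := fun h1 h2 =>
        by_contra fun h3 => hnC ⟨h1, h2, h3⟩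
      refine ih.step s t L _ ?_ (Wk_mono' hW hne ?_) hne hnd ?_ (Or.inl hs) (Or.inl ht) ?_ lat
      · intro x
        simp only [F2, Set.mem_ofPred_eq]
        clear * - hA hC
        tauto
      · intro x y hx hy hxy h
        have hx' : x ∈ S ∨ x ∈ L := hx.imp_left fun (h : x = s) => h ▸ hs
        have hy' : y ∈ S ∨ y ∈ L := hy.imp_left fun (h : y = t) => h ▸ ht
        rcases hK' _ _ h with h | (⟨rfl, rfl⟩ | ⟨rfl, rfl⟩) | (⟨rfl, rfl⟩ | ⟨rfl, rfl⟩)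
        · exact h
        · have := hA hx' hy'
          exact absurd hxy (not_or.2 ⟨fun h => hL _ h this.1, fun h => hL _ h this.2⟩)
        · have := hA hy' hx'
          exact absurd hxy (not_or.2 ⟨fun h => hL _ h this.2, fun h => hL _ h this.1⟩)
        · have := hC hx' hy'
          exact absurd hxy (not_or.2 ⟨fun h => hL _ h this.1, fun h => hL _ h this.2⟩)
        · have := hC hy' hx'
          exact absurd hxy (not_or.2 ⟨fun h => hL _ h this.2, fun h => hL _ h this.1⟩)
      · rintro x hx (h | ⟨rfl, -⟩ | ⟨rfl, -⟩)
        · exact hL _ hx h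
        · exact hvL hx
        · exact hwL hx
      · refine hst.imp_right fun h => ⟨?_, h.2⟩
        rw [h.1, F2_r hab hcd]
end
end Mond

namespace Mond

/-- The reduced form of a Mondshein sequence. -/
def Mon {V : Type u} (G : SimpleGraph V) (r u : V) : Prop :=
  NS G r {u}ᶜ ∧ G.Adj r u ∧ ∃ s t, s ≠ t ∧ s ≠ r ∧ t ≠ r ∧ G.Adj u s ∧ G.Adj u t

theorem Wk_map {V W : Type u} {R : V → V → Prop} {R' : W → W → Prop} {f : V → W}
    (hf : ∀ x y, R x y → R' (f x) (f y)) {s t : V} {L : List V} (h : Wk R s L t) :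
    Wk R' (f s) (L.map f) (f t) := by
  induction L generalizing s with
  | nil => exact hf _ _ h
  | cons x L ih => exact ⟨hf _ _ h.1, ih h.2⟩

theorem NS_map {V W : Type u} {G : SimpleGraph V} {K : SimpleGraph W} {f : V → W} {r : V} {S : Set V}
    (hf : Function.Injective f) (hG : ∀ x y, G.Adj x y → K.Adj (f x) (f y)) (h : NS G r S) :
    NS K (f r) (f '' S) := by
  induction h with
  | base => rw [Set.image_singleton]; exact NS.base
  | @step' S s t L hS hW hne hnd hL hs ht hst hl ih =>
    refine ih.step (f s) (f t) (L.map f) _ ?_ (Wk_map hG hW) (by simpa using hne) (hnd.map hf) ?_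
      ⟨s, hs, rfl⟩ ⟨t, ht, rfl⟩ ?_ ?_
    · intro x
      simp only [Set.mem_image, List.mem_map, Set.mem_ofPred_eq]
      constructor
      · rintro ⟨y, h | h, rfl⟩
        · exact Or.inl ⟨y, h, rfl⟩
        · exact Or.inr ⟨y, h, rfl⟩
      · rintro (⟨y, h, rfl⟩ | ⟨y, h, rfl⟩)
        · exact ⟨y, Or.inl h, rfl⟩
        · exact ⟨y, Or.inr h, rfl⟩
    · intro x hx
      obtain ⟨y, hy, rfl⟩ := List.mem_map.1 hx
      rintro ⟨z, hz, h⟩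
      exact hL y hy (hf h ▸ hz)
    · refine hst.imp hf.ne fun h => ⟨by rw [h.1, Set.image_singleton], by simpa using h.2⟩
    · intro x hx
      obtain ⟨y, hy, rfl⟩ := List.mem_map.1 hx
      obtain ⟨z, h1, h2, h3⟩ := hl y hy
      refine ⟨f z, hG _ _ h1, ?_⟩
      rintro ⟨p, hp, h⟩
      rw [hf h] at hp
      exact hp.elim h2 h3

section
variable {W : Type u} {K H : SimpleGraph W} {r u a b c d v w s t : W}

theorem EVfin_eq (hwa : w ≠ a) (hwb : w ≠ b) (hwv : w ≠ v)
    (hH : ∀ x, ¬ H.Adj v x) (hru : H.Adj r u)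
    (hK : ∀ x y, H.Adj x y → s(x, y) ≠ s(a, b) → K.Adj x y)
    (hva : K.Adj v a) (hvb : K.Adj v b) (hvw : K.Adj v w)
    (hs : H.Adj u s) (ht : H.Adj u t) (hst : s ≠ t) (hsr : s ≠ r) (htr : t ≠ r)
    (h : NS H r {x | x ≠ v ∧ x ≠ u}) (har : a = r) (hbu : b = u) : Mon K r v := by
  subst har hbu
  have hH' : ∀ x y, H.Adj x y → x ≠ v ∧ y ≠ v := fun x y h =>
    ⟨fun e => hH y (e ▸ h), fun e => hH x (e ▸ h.symm)⟩
  have hi := (EVind hru.ne hwa hwb (hH' _ _ hru).1 (hH' _ _ hru).1 (hH' _ _ hru).2 hwv hH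
    (fun x y _ _ h h1 h2 => hK x y h (by rw [Ne, Sym2.eq_iff]; exact not_or.2 ⟨h1, h2⟩)) hva hvb hvw h).2
  have hks : ∀ s, H.Adj b s → s ≠ a → K.Adj b s := fun s hs hsr => hK _ _ hs (by
    rw [Ne, Sym2.eq_iff]
    rintro (⟨h, -⟩ | ⟨-, h⟩)
    · exact hru.ne h.symm
    · exact hsr h)
  refine ⟨?_, hva.symm, b, w, hwb.symm, hru.ne.symm, hwa, hvb, hvw⟩
  refine hi.step s t [b] _ ?_ ⟨(hks s hs hsr).symm, hks t ht htr⟩ (by simp) (by simp) ?_ ?_ ?_ (Or.inl hst) ?_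
  · intro x
    have := (hH' _ _ hru).2
    simp [F1]
    grind
  · intro x hx
    have := (hH' _ _ hru).2
    simp [F1] at hx ⊢
    grind
  · exact Or.inl ⟨(hH' _ _ hs).2, hs.ne.symm⟩
  · exact Or.inl ⟨(hH' _ _ ht).2, ht.ne.symm⟩
  · intro x hx
    simp at hx
    subst hx
    exact ⟨v, hvb.symm, by simp⟩

theorem EVfin_ne (hab : a ≠ b) (hav : a ≠ v) (hbv : b ≠ v) (hwa : w ≠ a) (hwb : w ≠ b) (hwv : w ≠ v)
    (hH : ∀ x, ¬ H.Adj v x) (hru : H.Adj r u)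
    (hK : ∀ x y, H.Adj x y → s(x, y) ≠ s(a, b) → K.Adj x y)
    (hva : K.Adj v a) (hvb : K.Adj v b) (hvw : K.Adj v w)
    (hs : H.Adj u s) (ht : H.Adj u t) (hst : s ≠ t) (hsr : s ≠ r) (htr : t ≠ r)
    (h : NS H r {x | x ≠ v ∧ x ≠ u}) (hne : s(a, b) ≠ s(r, u)) : Mon K r u := by
  have hH' : ∀ x y, H.Adj x y → x ≠ v ∧ y ≠ v := fun x y h =>
    ⟨fun e => hH y (e ▸ h), fun e => hH x (e ▸ h.symm)⟩
  have hi := (EVind hab hwa hwb (hH' _ _ hru).1 hav hbv hwv hH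
    (fun x y _ _ h h1 h2 => hK x y h (by rw [Ne, Sym2.eq_iff]; exact not_or.2 ⟨h1, h2⟩)) hva hvb hvw h).2
  have hrv := (hH' _ _ hru).1
  have huv := (hH' _ _ hru).2
  refine ⟨?_, hK _ _ hru hne.symm, ?_⟩
  · have key : ∀ a b, a ≠ b → a ≠ v → w ≠ a → w ≠ b → K.Adj v a → K.Adj v b → b = u →
        NS K r (F1 a b v {x | x ≠ v ∧ x ≠ u}) → NS K r {u}ᶜ := by
      rintro a b hab hav hwa hwb hva hvb rfl hi
      refine hi.step a w [v] _ ?_ ⟨hva.symm, hvw⟩ (by simp) (by simp) ?_ ?_ ?_ (Or.inl hwa.symm) ?_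
      · intro x
        simp [F1]
        grind
      · intro x hx
        simp [F1] at hx ⊢
        grind
      · exact Or.inl ⟨hav, hab⟩
      · exact Or.inl ⟨hwv, hwb⟩
      · intro x hx
        simp at hx
        subst hx
        exact ⟨b, hvb, by simp⟩
    by_cases hb : b = u
    · exact key a b hab hav hwa hwb hva hvb hb hi
    by_cases ha : a = u
    · refine key b a hab.symm hbv hwb hwa hvb hva ha (hi.cast fun x => ?_)
      simp [F1]; grind
    refine hi.cast fun x => ?_
    simp [F1]; grind
  · by_cases h1 : s(u, s) = s(a, b)
    · have hvu : K.Adj u v := by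
        rcases Sym2.eq_iff.1 h1 with ⟨rfl, -⟩ | ⟨rfl, -⟩
        exacts [hva.symm, hvb.symm]
      exact ⟨v, t, (hH' _ _ ht).2.symm, hrv.symm, htr, hvu, hK _ _ ht (by
        rw [← h1]; exact fun h => hst (Sym2.congr_right.1 h).symm)⟩
    by_cases h2 : s(u, t) = s(a, b)
    · have hvu : K.Adj u v := by
        rcases Sym2.eq_iff.1 h2 with ⟨rfl, -⟩ | ⟨rfl, -⟩
        exacts [hva.symm, hvb.symm]
      exact ⟨s, v, (hH' _ _ hs).2, hsr, hrv.symm, hK _ _ hs h1, hvu⟩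
    exact ⟨s, t, hst, hsr, htr, hK _ _ hs h1, hK _ _ ht h2⟩

theorem eeK (hK : ∀ x y, H.Adj x y → s(x, y) ≠ s(a, b) → s(x, y) ≠ s(c, d) → K.Adj x y) :
    ∀ x y, H.Adj x y → K.Adj x y ∨ ((x = a ∧ y = b) ∨ (x = b ∧ y = a)) ∨
      ((x = c ∧ y = d) ∨ (x = d ∧ y = c)) := by
  intro x y h
  by_cases h1 : s(x, y) = s(a, b)
  · exact Or.inr (Or.inl (by simpa using Sym2.eq_iff.1 h1))
  by_cases h2 : s(x, y) = s(c, d)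
  · exact Or.inr (Or.inr (by simpa using Sym2.eq_iff.1 h2))
  exact Or.inl (hK _ _ h h1 h2)

/-- The assumptions of the edge-edge-addition on one vertex set. -/
structure EE (H K : SimpleGraph W) (a b v c d w : W) : Prop where
  hab : a ≠ b
  hcd : c ≠ d
  hne : s(a, b) ≠ s(c, d)
  hav : a ≠ v
  hbv : b ≠ v
  hcv : c ≠ v
  hdv : d ≠ v
  haw : a ≠ w
  hbw : b ≠ w
  hcw : c ≠ w
  hdw : d ≠ w
  hHv : ∀ x, ¬ H.Adj v x
  hHw : ∀ x, ¬ H.Adj w x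
  hvw : K.Adj v w
  hva : K.Adj v a
  hvb : K.Adj v b
  hwc : K.Adj w c
  hwd : K.Adj w d
  hNv : ∀ x, K.Adj v x → x = a ∨ x = b ∨ x = w
  hNw : ∀ x, K.Adj w x → x = c ∨ x = d ∨ x = v
  hK : ∀ x y, H.Adj x y → s(x, y) ≠ s(a, b) → s(x, y) ≠ s(c, d) → K.Adj x y

theorem EE.sw (E : EE H K a b v c d w) : EE H K c d w a b v :=
  ⟨E.hcd, E.hab, E.hne.symm, E.hcw, E.hdw, E.haw, E.hbw, E.hcv, E.hdv, E.hav, E.hbv, E.hHw, E.hHv,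
    E.hvw.symm, E.hwc, E.hwd, E.hva, E.hvb, E.hNw, E.hNv, fun x y h h1 h2 => E.hK x y h h2 h1⟩

theorem EE.fl (E : EE H K a b v c d w) : EE H K b a v c d w :=
  ⟨E.hab.symm, E.hcd, by rw [Sym2.eq_swap]; exact E.hne, E.hbv, E.hav, E.hcv, E.hdv, E.hbw, E.haw, E.hcw, E.hdw,
    E.hHv, E.hHw, E.hvw, E.hvb, E.hva, E.hwc, E.hwd, fun x h => by have := E.hNv x h; tauto, E.hNw,
    fun x y h h1 h2 => E.hK x y h (by rw [Sym2.eq_swap (a := a)]; exact h1) h2⟩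

theorem EE.ind (E : EE H K a b v c d w) {S : Set W} (hrv : r ≠ v) (hrw : r ≠ w) (h : NS H r S) :
    NS K r (F2 a b v c d w S) :=
  (EEind E.hab E.hcd E.hne hrv hrw E.hav E.hbv E.hcv E.hdv E.haw E.hbw E.hcw E.hdw E.hHv E.hHw
    E.hvw E.hva E.hvb E.hwc E.hwd E.hNv E.hNw (eeK E.hK) h).2.2

theorem EE.iso (E : EE H K a b v c d w) {x y : W} (h : H.Adj x y) : x ≠ v ∧ y ≠ v ∧ x ≠ w ∧ y ≠ w :=
  ⟨fun e => E.hHv y (e ▸ h), fun e => E.hHv x (e ▸ h.symm), fun e => E.hHw y (e ▸ h),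
    fun e => E.hHw x (e ▸ h.symm)⟩

theorem EE.fin_eq (E : EE H K a b v c d w) (hru : H.Adj r u)
    (hs : H.Adj u s) (ht : H.Adj u t) (hst : s ≠ t) (hsr : s ≠ r) (htr : t ≠ r)
    (h : NS H r {x | x ≠ v ∧ x ≠ w ∧ x ≠ u}) (har : a = r) (hbu : b = u) : Mon K r v := by
  subst har hbu
  have hi := E.ind E.hav E.haw h
  have hvw := E.hvw.ne
  have hbv := E.hbv
  have hbw := E.hbw
  have hks : ∀ s, H.Adj b s → s ≠ a → s(b, s) ≠ s(c, d) → K.Adj b s := fun s hs hsr => E.hK _ _ hs (by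
    rw [Ne, Sym2.eq_iff]
    rintro (⟨h, -⟩ | ⟨-, h⟩)
    · exact hru.ne h.symm
    · exact hsr h)
  refine ⟨?_, E.hva.symm, b, w, E.hbw, hru.ne.symm, E.haw.symm, E.hvb, E.hvw⟩
  have hsI := E.iso hs
  have htI := E.iso ht
  have key : ∀ c d, b = d → EE H K a b v c d w → NS K a (F2 a b v c d w {x | x ≠ v ∧ x ≠ w ∧ x ≠ b}) →
      NS K a {v}ᶜ := by
    rintro c d rfl E hi
    have hca : c ≠ a := by rintro rfl; exact E.hne rfl
    have : ∃ x, H.Adj b x ∧ x ≠ a ∧ x ≠ c := by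
      by_cases hsc : s = c
      · exact ⟨t, ht, htr, fun h => hst (hsc.trans h.symm)⟩
      · exact ⟨s, hs, hsr, hsc⟩
    obtain ⟨x, h1, h2, h3⟩ := this
    have hxI := E.iso h1
    have hbx : K.Adj b x := E.hK _ _ h1 (by
        rw [Ne, Sym2.eq_iff]
        rintro (⟨h, -⟩ | ⟨-, h⟩)
        · exact hru.ne h.symm
        · exact h2 h) (by
        rw [Ne, Sym2.eq_iff]
        rintro (⟨h, -⟩ | ⟨-, h⟩)
        · exact E.hcd h.symm
        · exact h3 h)
    refine hi.step x c [b, w] _ ?_ ⟨hbx.symm, E.hwd.symm, E.hwc⟩ (by simp) (by simp [hbw]) ?_ ?_ ?_ (Or.inl h3) ?_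
    · intro x
      simp [F2]
      clear * - hbv hvw hbw
      grind
    · intro x hx
      simp [F2] at hx ⊢
      clear * - hx hbv hvw hbw
      grind
    · exact Or.inl ⟨hxI.2.1, hxI.2.2.2, h1.ne.symm⟩
    · exact Or.inl ⟨E.hcv, E.hcw, E.hcd⟩
    · intro x hx
      refine ⟨v, ?_, by simp⟩
      simp at hx
      rcases hx with rfl | rfl
      · exact E.hvb.symm
      · exact E.hvw.symm
  by_cases hd : b = d
  · exact key c d hd E hi
  by_cases hc : b = c
  · refine key d c hc E.sw.fl.sw (hi.cast fun x => ?_)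
    simp [F2]; clear * -; tauto
  have hcd : ∀ s, s(b, s) ≠ s(c, d) := fun s => by
    rw [Ne, Sym2.eq_iff]
    rintro (⟨h, -⟩ | ⟨h, -⟩)
    exacts [hc h, hd h]
  refine hi.step s t [b] _ ?_ ⟨(hks s hs hsr (hcd s)).symm, hks t ht htr (hcd t)⟩ (by simp) (by simp) ?_ ?_ ?_ (Or.inl hst) ?_
  · intro x
    have := E.hcv
    have := E.hdv
    have := E.hcw
    have := E.hdw
    simp [F2]
    clear hks key
    grind
  · intro x hx
    simp [F2] at hx ⊢
    clear hks key
    grind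
  · exact Or.inl ⟨hsI.2.1, hsI.2.2.2, hs.ne.symm⟩
  · exact Or.inl ⟨htI.2.1, htI.2.2.2, ht.ne.symm⟩
  · intro x hx
    simp at hx
    subst hx
    exact ⟨v, E.hvb.symm, by simp⟩

theorem EE.fin_v (E : EE H K a b v c d w) (huv : u ≠ v) (huw : u ≠ w)
    (hi : NS K r (F2 a b v c d w {x | x ≠ v ∧ x ≠ w ∧ x ≠ u})) (hbu : b = u) (hc : c ≠ u) (hd : d ≠ u) :
    NS K r {u}ᶜ := by
  subst hbu
  have hvw := E.hvw.ne
  have hcv := E.hcv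
  have hcw := E.hcw
  have hdw := E.hdw
  have hdv := E.hdv
  refine hi.step a w [v] _ ?_ ⟨E.hva.symm, E.hvw⟩ (by simp) (by simp) ?_ ?_ ?_ (Or.inl E.haw) ?_
  · intro x
    simp [F2]
    clear hi E
    grind
  · intro x hx
    simp [F2] at hx ⊢
    clear hi E
    grind
  · exact Or.inl ⟨E.hav, E.haw, E.hab⟩
  · exact Or.inr (Or.inr ⟨rfl, ⟨hcv, hcw, hc⟩, ⟨hdv, hdw, hd⟩⟩)
  · intro x hx
    simp at hx
    subst hx
    exact ⟨b, E.hvb, by simp⟩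

theorem EE.fin_vw (E : EE H K a b v c d w) (huv : u ≠ v) (huw : u ≠ w)
    (hi : NS K r (F2 a b v c d w {x | x ≠ v ∧ x ≠ w ∧ x ≠ u})) (hbu : b = u) (hdu : d = u) :
    NS K r {u}ᶜ := by
  subst hbu hdu
  have hvw := E.hvw.ne
  have hac : a ≠ c := by rintro rfl; exact E.hne rfl
  refine hi.step a c [v, w] _ ?_ ⟨E.hva.symm, E.hvw, E.hwc⟩ (by simp) (by simp [hvw]) ?_ ?_ ?_ (Or.inl hac) ?_
  · intro x
    simp [F2]
    clear hi E
    grind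
  · intro x hx
    simp [F2] at hx ⊢
    clear hi E
    grind
  · exact Or.inl ⟨E.hav, E.haw, E.hab⟩
  · exact Or.inl ⟨E.hcv, E.hcw, E.hcd⟩
  · intro x hx
    simp at hx
    rcases hx with rfl | rfl
    · exact ⟨d, E.hvb, by simp⟩
    · exact ⟨d, E.hwd, by simp⟩

theorem F2_flip1 {S : Set W} : F2 a b v c d w S = F2 b a v c d w S := by
  ext x
  simp only [F2, Set.mem_ofPred_eq, and_comm (a := a ∈ S)]

theorem F2_flip2 {S : Set W} : F2 a b v c d w S = F2 a b v d c w S := by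
  ext x
  simp only [F2, Set.mem_ofPred_eq, and_comm (a := c ∈ S)]

theorem set3_swap : {x : W | x ≠ w ∧ x ≠ v ∧ x ≠ u} = {x | x ≠ v ∧ x ≠ w ∧ x ≠ u} := by
  ext x
  simp only [Set.mem_ofPred_eq]
  exact and_left_comm

theorem EE.fin_NS (E : EE H K a b v c d w) (huv : u ≠ v) (huw : u ≠ w)
    (hi : NS K r (F2 a b v c d w {x | x ≠ v ∧ x ≠ w ∧ x ≠ u})) : NS K r {u}ᶜ := by
  have key : ∀ a b, EE H K a b v c d w → NS K r (F2 a b v c d w {x | x ≠ v ∧ x ≠ w ∧ x ≠ u}) → b = u →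
      NS K r {u}ᶜ := by
    intro a b E hi hb
    by_cases hd : d = u
    · exact E.fin_vw huv huw hi hb hd
    by_cases hc : c = u
    · refine E.sw.fl.sw.fin_vw huv huw ?_ hb hc
      rw [F2_flip2]; exact hi
    exact E.fin_v huv huw hi hb hc hd
  by_cases hb : b = u
  · exact key a b E hi hb
  by_cases ha : a = u
  · refine key b a E.fl ?_ ha
    rw [F2_flip1]; exact hi
  by_cases hd : d = u
  · refine E.sw.fin_v huw huv ?_ hd ha hb
    rw [set3_swap, F2_swap]; exact hi
  by_cases hc : c = u
  · refine E.sw.fl.fin_v huw huv ?_ hc ha hb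
    rw [set3_swap, F2_swap, F2_flip2]; exact hi
  refine hi.cast fun x => ?_
  have := E.hav
  have := E.hbv
  have := E.hcv
  have := E.hdv
  have := E.haw
  have := E.hbw
  have := E.hcw
  have := E.hdw
  simp [F2]
  clear hi E key
  grind

theorem EE.fin_ne (E : EE H K a b v c d w) (hru : H.Adj r u)
    (hs : H.Adj u s) (ht : H.Adj u t) (hst : s ≠ t) (hsr : s ≠ r) (htr : t ≠ r)
    (h : NS H r {x | x ≠ v ∧ x ≠ w ∧ x ≠ u}) (hn1 : s(a, b) ≠ s(r, u)) (hn2 : s(c, d) ≠ s(r, u)) :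
    Mon K r u := by
  obtain ⟨hrv, huv, hrw, huw⟩ := E.iso hru
  have hi := E.ind hrv hrw h
  refine ⟨E.fin_NS huv huw hi, E.hK _ _ hru hn1.symm hn2.symm, ?_⟩
  · have key : ∀ x, H.Adj u x → ∃ y, K.Adj u y ∧ ((y = x ∧ s(u, x) ≠ s(a, b) ∧ s(u, x) ≠ s(c, d)) ∨
        (y = v ∧ s(u, x) = s(a, b)) ∨ (y = w ∧ s(u, x) = s(c, d))) := by
      intro x hx
      by_cases h1 : s(u, x) = s(a, b)
      · have hvu : K.Adj u v := by
          rcases Sym2.eq_iff.1 h1 with ⟨rfl, -⟩ | ⟨rfl, -⟩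
          exacts [E.hva.symm, E.hvb.symm]
        exact ⟨v, hvu, Or.inr (Or.inl ⟨rfl, h1⟩)⟩
      by_cases h2 : s(u, x) = s(c, d)
      · have hvu : K.Adj u w := by
          rcases Sym2.eq_iff.1 h2 with ⟨rfl, -⟩ | ⟨rfl, -⟩
          exacts [E.hwc.symm, E.hwd.symm]
        exact ⟨w, hvu, Or.inr (Or.inr ⟨rfl, h2⟩)⟩
      exact ⟨x, E.hK _ _ hx h1 h2, Or.inl ⟨rfl, h1, h2⟩⟩
    obtain ⟨s', k1, k2⟩ := key s hs
    obtain ⟨t', k3, k4⟩ := key t ht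
    have hsI := E.iso hs
    have htI := E.iso ht
    have hvw := E.hvw.ne
    have hinj : s(u, s) ≠ s(u, t) := by
      intro h; exact hst (Sym2.congr_right.1 h)
    refine ⟨s', t', ?_, ?_, ?_, k1, k3⟩
    · rintro rfl
      clear E hi h key k1 k3
      grind
    · rintro rfl
      clear E hi h key k1 k3 k4
      grind
    · rintro rfl
      clear E hi h key k1 k3 k2
      grind
end
end Mond

namespace Mond
section
variable {V W : Type u} {G : SimpleGraph V} {G' : SimpleGraph W} {r u : V}

theorem Mon_VV (h : Mon G r u) (e : V ≃ W) (hadj : ∀ x y, G.Adj x y → G'.Adj (e x) (e y)) :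
    Mon G' (e r) (e u) := by
  obtain ⟨h1, h2, s, t, h3, h4, h5, h6, h7⟩ := h
  refine ⟨(NS_map e.injective hadj h1).cast ?_, hadj _ _ h2, e s, e t, e.injective.ne h3,
    e.injective.ne h4, e.injective.ne h5, hadj _ _ h6, hadj _ _ h7⟩
  intro x
  obtain ⟨y, rfl⟩ := e.surjective x
  simp

theorem map_iso {f : V ↪ W} {v : W} (hv : ∀ x, f x ≠ v) : ∀ x, ¬ (G.map f).Adj v x := by
  rintro x ⟨-, y, z, h, h2, h3⟩
  exact hv _ h2

theorem sym2_f {f : V ↪ W} {x y a b : V} : s(f x, f y) = s(f a, f b) ↔ s(x, y) = s(a, b) := by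
  simp [Sym2.eq_iff]

theorem map_adj {f : V ↪ W} {x y : V} (h : G.Adj x y) : (G.map f).Adj (f x) (f y) :=
  (SimpleGraph.map_adj_apply).2 h

theorem Mon_EV (h : Mon G r u) (f : V ↪ W) (v : W) (a b w₀ : V)
    (hv : ∀ x, f x ≠ v) (hc : ∀ z : W, z = v ∨ ∃ x, f x = z)
    (hab : G.Adj a b) (hwa : w₀ ≠ a) (hwb : w₀ ≠ b)
    (hadj : ∀ x y : V, G'.Adj (f x) (f y) ↔ (G.Adj x y ∧ s(x, y) ≠ s(a, b)))
    (hav : ∀ x : V, G'.Adj v (f x) ↔ (x = a ∨ x = b ∨ x = w₀)) :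
    (s(a, b) = s(r, u) → Mon G' (f r) v) ∧ (s(a, b) ≠ s(r, u) → Mon G' (f r) (f u)) := by
  obtain ⟨h1, h2, s, t, h3, h4, h5, h6, h7⟩ := h
  have hns : NS (G.map f) (f r) {x | x ≠ v ∧ x ≠ f u} := by
    refine (NS_map f.injective (fun x y h => map_adj h) h1).cast fun x => ?_
    rcases hc x with rfl | ⟨x, rfl⟩
    · simp [hv]
    · simp [hv]
  have hK : ∀ x y, (G.map f).Adj x y → s(x, y) ≠ s(f a, f b) → G'.Adj x y := by
    rintro _ _ ⟨-, x, y, h, rfl, rfl⟩ hn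
    exact (hadj _ _).2 ⟨h, fun e => hn (sym2_f.2 e)⟩
  have hva := (hav a).2 (by simp)
  have hvb := (hav b).2 (by simp)
  have hvw := (hav w₀).2 (by simp)
  constructor
  · intro he
    rcases Sym2.eq_iff.1 he with ⟨rfl, rfl⟩ | ⟨rfl, rfl⟩
    · exact EVfin_eq (f.injective.ne hwa) (f.injective.ne hwb) (hv _) (map_iso hv) (map_adj h2) hK
        hva hvb hvw (map_adj h6) (map_adj h7) (f.injective.ne h3) (f.injective.ne h4)
        (f.injective.ne h5) hns rfl rfl
    · exact EVfin_eq (f.injective.ne hwb) (f.injective.ne hwa) (hv _) (map_iso hv) (map_adj h2)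
        (fun x y h hn => hK x y h (by rw [Sym2.eq_swap (a := f a)]; exact hn))
        hvb hva hvw (map_adj h6) (map_adj h7) (f.injective.ne h3) (f.injective.ne h4)
        (f.injective.ne h5) hns rfl rfl
  · intro hne
    exact EVfin_ne (f.injective.ne hab.ne) (hv _) (hv _) (f.injective.ne hwa) (f.injective.ne hwb)
        (hv _) (map_iso hv) (map_adj h2) hK
        hva hvb hvw (map_adj h6) (map_adj h7) (f.injective.ne h3) (f.injective.ne h4)
        (f.injective.ne h5) hns (fun e => hne (sym2_f.1 e))

theorem Mon_EE (h : Mon G r u) (f : V ↪ W) (v w : W) (a b c d : V)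
    (hvw : v ≠ w) (hv : ∀ x, f x ≠ v ∧ f x ≠ w) (hcov : ∀ z : W, z = v ∨ z = w ∨ ∃ x, f x = z)
    (hab : G.Adj a b) (hcd : G.Adj c d) (hne : s(a, b) ≠ s(c, d))
    (hadj : ∀ x y : V, G'.Adj (f x) (f y) ↔ (G.Adj x y ∧ s(x, y) ≠ s(a, b) ∧ s(x, y) ≠ s(c, d)))
    (hav : ∀ x : V, G'.Adj v (f x) ↔ (x = a ∨ x = b))
    (haw : ∀ x : V, G'.Adj w (f x) ↔ (x = c ∨ x = d))
    (hvw' : G'.Adj v w) :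
    (s(a, b) = s(r, u) → Mon G' (f r) v) ∧ (s(c, d) = s(r, u) → Mon G' (f r) w) ∧
    (s(a, b) ≠ s(r, u) → s(c, d) ≠ s(r, u) → Mon G' (f r) (f u)) := by
  obtain ⟨h1, h2, s, t, h3, h4, h5, h6, h7⟩ := h
  have hns : NS (G.map f) (f r) {x | x ≠ v ∧ x ≠ w ∧ x ≠ f u} := by
    refine (NS_map f.injective (fun x y h => map_adj h) h1).cast fun x => ?_
    rcases hcov x with rfl | rfl | ⟨x, rfl⟩
    · simp [hv]
    · simp [hv]
    · simp [hv]
  have hns' := hns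
  rw [← set3_swap] at hns'
  have E : EE (G.map f) G' (f a) (f b) v (f c) (f d) w := by
    refine ⟨f.injective.ne hab.ne, f.injective.ne hcd.ne, fun e => hne (sym2_f.1 e), (hv _).1, (hv _).1,
      (hv _).1, (hv _).1, (hv _).2, (hv _).2, (hv _).2, (hv _).2, map_iso fun x => (hv x).1,
      map_iso fun x => (hv x).2, hvw', (hav _).2 (by simp), (hav _).2 (by simp), (haw _).2 (by simp),
      (haw _).2 (by simp), ?_, ?_, ?_⟩
    · intro x hx
      rcases hcov x with rfl | rfl | ⟨x, rfl⟩
      · exact (hx.ne rfl).elim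
      · simp
      · rcases (hav _).1 hx with rfl | rfl <;> simp
    · intro x hx
      rcases hcov x with rfl | rfl | ⟨x, rfl⟩
      · simp
      · exact (hx.ne rfl).elim
      · rcases (haw _).1 hx with rfl | rfl <;> simp
    · rintro _ _ ⟨-, x, y, h, rfl, rfl⟩ hn hn'
      exact (hadj _ _).2 ⟨h, fun e => hn (sym2_f.2 e), fun e => hn' (sym2_f.2 e)⟩
  refine ⟨fun he => ?_, fun he => ?_, fun hn1 hn2 => ?_⟩
  · rcases Sym2.eq_iff.1 he with ⟨rfl, rfl⟩ | ⟨rfl, rfl⟩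
    · exact E.fin_eq (map_adj h2) (map_adj h6) (map_adj h7) (f.injective.ne h3) (f.injective.ne h4)
        (f.injective.ne h5) hns rfl rfl
    · exact E.fl.fin_eq (map_adj h2) (map_adj h6) (map_adj h7) (f.injective.ne h3) (f.injective.ne h4)
        (f.injective.ne h5) hns rfl rfl
  · rcases Sym2.eq_iff.1 he with ⟨rfl, rfl⟩ | ⟨rfl, rfl⟩
    · exact E.sw.fin_eq (map_adj h2) (map_adj h6) (map_adj h7) (f.injective.ne h3) (f.injective.ne h4)
        (f.injective.ne h5) hns' rfl rfl
    · exact E.sw.fl.fin_eq (map_adj h2) (map_adj h6) (map_adj h7) (f.injective.ne h3) (f.injective.ne h4)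
        (f.injective.ne h5) hns' rfl rfl
  · exact E.fin_ne (map_adj h2) (map_adj h6) (map_adj h7) (f.injective.ne h3) (f.injective.ne h4)
        (f.injective.ne h5) hns (fun e => hn1 (sym2_f.1 e)) (fun e => hn2 (sym2_f.1 e))
end
end Mond

namespace Mond
section
variable {V : Type u} {G : SimpleGraph V} {r u : V}

theorem Wk_imp {R R' : V → V → Prop} {s t : V} {L : List V} (hR : ∀ x y, R' x y → R x y)
    (h : Wk R' s L t) : Wk R s L t :=
  Wk_mono h (fun _ => True) trivial trivial (fun _ _ => trivial) fun x y _ _ => hR x y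

theorem walk_list {x y : V} (p : G.Walk x y) (hp : 0 < p.length) :
    ∃ L, p.support = x :: (L ++ [y]) ∧ Wk (fun a b => s(a, b) ∈ p.edges) x L y := by
  induction p with
  | nil => simp at hp
  | @cons x z y h q ih =>
    cases q with
    | nil => exact ⟨[], by simp, by simp [Wk]⟩
    | @cons _ z' _ h' q =>
      obtain ⟨L, h1, h2⟩ := ih (by simp)
      refine ⟨z :: L, by rw [Walk.support_cons, h1]; rfl, ?_, ?_⟩
      · simp
      · exact Wk_imp (fun a b h => by rw [Walk.edges_cons]; exact List.mem_cons_of_mem _ h) h2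

theorem mem_P (D : EarDecomposition G) {i : ℕ} {x : V} :
    x ∈ (D.partialGraph i).verts ↔ ∃ j ≤ i, x ∈ D.earSupport j := by
  simp [EarDecomposition.partialGraph, EarDecomposition.earSupport, Nat.lt_succ_iff]

theorem sup0 (D : EarDecomposition G) {x : V} : x ∈ D.earSupport 0 ↔ x ∈ D.cycle.support := by
  simp [EarDecomposition.earSupport, EarDecomposition.ear]

theorem supS (D : EarDecomposition G) {i : ℕ} (h : i < D.k) {x : V} :
    x ∈ D.earSupport (i + 1) ↔ x ∈ (D.path ⟨i, h⟩).support := by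
  simp [EarDecomposition.earSupport, EarDecomposition.ear, h]

theorem supN (D : EarDecomposition G) {i : ℕ} (h : ¬ i < D.k) {x : V} :
    ¬ x ∈ D.earSupport (i + 1) := by
  simp [EarDecomposition.earSupport, EarDecomposition.ear, h]

theorem edgS (D : EarDecomposition G) {i : ℕ} (h : i < D.k) {e : Sym2 V} :
    e ∈ D.earEdges (i + 1) ↔ e ∈ (D.path ⟨i, h⟩).edges := by
  simp [EarDecomposition.earEdges, EarDecomposition.ear, h]

theorem innS (D : EarDecomposition G) {i : ℕ} (h : i < D.k) {x : V} :
    x ∈ D.inner (i + 1) ↔ x ∈ (D.path ⟨i, h⟩).support ∧ x ≠ D.s ⟨i, h⟩ ∧ x ≠ D.t ⟨i, h⟩ := by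
  simp [EarDecomposition.inner, h]

theorem inn0 (D : EarDecomposition G) {x : V} : x ∈ D.inner 0 ↔ x ∈ D.cycle.support := by
  simp [EarDecomposition.inner, sup0]

theorem P_succ (D : EarDecomposition G) {i : ℕ} {x : V} :
    x ∈ (D.partialGraph (i + 1)).verts ↔ x ∈ (D.partialGraph i).verts ∨ x ∈ D.earSupport (i + 1) := by
  simp only [mem_P]
  constructor
  · rintro ⟨j, hj, hx⟩
    rcases Nat.lt_or_eq_of_le hj with h | rfl
    · exact Or.inl ⟨j, by omega, hx⟩
    · exact Or.inr hx
  · rintro (⟨j, hj, hx⟩ | hx)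
    · exact ⟨j, by omega, hx⟩
    · exact ⟨_, le_rfl, hx⟩

theorem meets (D : EarDecomposition G) {i : ℕ} (h : i < D.k) {x : V} (hx : x ∈ (D.path ⟨i, h⟩).support) :
    x ∈ (D.partialGraph i).verts ↔ x = D.s ⟨i, h⟩ ∨ x = D.t ⟨i, h⟩ := by
  rw [← D.meets_prev ⟨i, h⟩ x hx, mem_P]
  constructor
  · rintro ⟨j, hj, hx⟩
    rcases j with _ | j
    · exact Or.inl ((sup0 D).1 hx)
    · exact Or.inr ⟨⟨j, by omega⟩, by simp only [Fin.mk_lt_mk]; omega, (supS D (by omega)).1 hx⟩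
  · rintro (hx | ⟨⟨j, hj⟩, hji, hx⟩)
    · exact ⟨0, by omega, (sup0 D).2 hx⟩
    · simp only [Fin.mk_lt_mk] at hji
      exact ⟨j + 1, by omega, (supS D hj).2 hx⟩

theorem NS_P (D : EarDecomposition G) (hr : r ∈ D.earSupport 0) (hns : D.NonSeparating) (i : ℕ) (hi : i ≤ D.k)
    (hu : u ∉ (D.partialGraph i).verts) : NS G r (D.partialGraph i).verts := by
  induction i with
  | zero =>
    classical
    have hr' := (sup0 D).1 hr
    have hc : (D.cycle.rotate r hr').IsCycle := (Walk.isCycle_rotate hr').2 D.cycle_isCycle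
    obtain ⟨L, h1, h2⟩ := walk_list (D.cycle.rotate r hr') (by have := hc.three_le_length; omega)
    have hmem : ∀ x, x ∈ (D.partialGraph 0).verts ↔ x = r ∨ x ∈ L := by
      intro x
      have : x ∈ (D.cycle.rotate r hr').support ↔ x = r ∨ x ∈ L := by
        rw [h1]; simp; tauto
      rw [← this, Walk.mem_support_rotate_iff, mem_P]
      simp [sup0]
    have hnd : (L ++ [r]).Nodup := by
      have := hc.support_nodup
      rw [h1] at this
      exact this
    have hlen : 2 ≤ L.length := by
      have := hc.three_le_length
      have h3 := congrArg List.length h1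
      simp at h3
      simp at this
      omega
    have hrL : r ∉ L := by
      intro h
      rw [List.nodup_append] at hnd
      exact hnd.2.2 r h r (by simp) rfl
    refine (NS.base (K := G) (r := r)).step r r L _ (fun x => ?_) (Wk_imp ?_ h2) ?_
      (List.nodup_append.1 hnd).1 ?_ rfl rfl (Or.inr ⟨rfl, hlen⟩) ?_
    · rw [hmem]; rfl
    · exact fun a b h => Walk.adj_of_mem_edges _ h
    · rintro rfl; simp at hlen
    · rintro x hx rfl; exact hrL hx
    · intro x hx
      obtain ⟨y, hy, hxy⟩ := hns 0 hi ⟨u, hu⟩ x (by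
        have := (hmem x).2 (Or.inr hx)
        rw [mem_P] at this
        simpa [inn0, sup0] using this)
      exact ⟨y, hxy, hy⟩
  | succ i ih =>
    have hi' : i < D.k := by omega
    have ih := ih (by omega) (fun h => hu ((P_succ D).2 (Or.inl h)))
    obtain ⟨L, h1, h2⟩ := walk_list (D.path ⟨i, hi'⟩) (D.path_length_pos _)
    have hnd := (D.path_isPath ⟨i, hi'⟩).support_nodup
    rw [h1] at hnd
    have hsup : ∀ x, x ∈ (D.path ⟨i, hi'⟩).support ↔ x = D.s ⟨i, hi'⟩ ∨ x = D.t ⟨i, hi'⟩ ∨ x ∈ L := by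
      intro x; rw [h1]; simp; tauto
    have hs := (meets D hi' ((hsup _).2 (Or.inl rfl))).2 (Or.inl rfl)
    have ht := (meets D hi' ((hsup _).2 (Or.inr (Or.inl rfl)))).2 (Or.inr rfl)
    have hmem : ∀ x, x ∈ (D.partialGraph (i + 1)).verts ↔ x ∈ (D.partialGraph i).verts ∨ x ∈ L := by
      intro x
      rw [P_succ, supS D hi', hsup]
      constructor
      · rintro (h | rfl | rfl | h)
        exacts [Or.inl h, Or.inl hs, Or.inl ht, Or.inr h]
      · rintro (h | h)
        exacts [Or.inl h, Or.inr (Or.inr (Or.inr h))]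
    by_cases hL : L = []
    · subst hL
      refine ih.cast fun x => ?_
      rw [hmem]; simp
    simp only [List.nodup_cons, List.mem_append, List.mem_singleton, not_or, List.nodup_append] at hnd
    obtain ⟨⟨n1, n2⟩, n3, -, n4⟩ := hnd
    have hLs : ∀ x ∈ L, x ≠ D.s ⟨i, hi'⟩ ∧ x ≠ D.t ⟨i, hi'⟩ := fun x hx =>
      ⟨fun h => n1 (h ▸ hx), n4 x hx _ rfl⟩
    refine ih.step _ _ L _ hmem (Wk_imp ?_ h2) hL n3 ?_ hs ht (Or.inl n2) ?_
    · exact fun a b h => Walk.adj_of_mem_edges _ h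
    · intro x hx h
      rcases (meets D hi' ((hsup _).2 (Or.inr (Or.inr hx)))).1 h with h | h
      exacts [(hLs x hx).1 h, (hLs x hx).2 h]
    · intro x hx
      obtain ⟨y, hy, hxy⟩ := hns (i + 1) hi ⟨u, hu⟩ x
        ((innS D hi').2 ⟨(hsup x).2 (Or.inr (Or.inr hx)), hLs x hx⟩)
      exact ⟨y, hxy, hy⟩

theorem D_to_Mon (D : EarDecomposition G) (hD : IsMondshein D r u) (hru : G.Adj r u)
    (hiso : ∀ x, ∃ y, G.Adj x y) : Mon G r u := by
  obtain ⟨hr, hl, hlast, hin, hru', hns⟩ := hD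
  have hub : u ∈ D.inner (D.birth u) := by rw [hin]; rfl
  have hm : ∃ i, i < D.k ∧ D.birth u = i + 1 := by
    rcases hb : D.birth u with _ | i
    · exfalso
      rw [hb] at hin
      have h1 : r ∈ D.inner 0 := by rw [inn0, ← sup0]; exact hr
      rw [hin] at h1
      exact hru.ne h1
    · refine ⟨i, ?_, rfl⟩
      by_contra hk
      rw [hb] at hub
      simp [EarDecomposition.inner, hk] at hub
  obtain ⟨i, hi, hb⟩ := hm
  have hbirth : ∀ x, (∃ j, x ∈ D.earSupport j) → x ∈ D.earSupport (D.birth x) := fun x h => Nat.sInf_mem h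
  have hbl : ∀ x j, x ∈ D.earSupport j → D.birth x ≤ j := fun x j h => Nat.sInf_le h
  have huP : u ∉ (D.partialGraph i).verts := by
    rw [mem_P]
    rintro ⟨j, hj, h⟩
    have := hbl u j h
    omega
  have hNS := NS_P D hr hns i (by omega) huP
  rw [hb] at hin hru' hub
  refine ⟨hNS.cast fun x => ?_, hru, ?_⟩
  · symm
    constructor
    · intro h
      rintro rfl
      exact huP h
    · intro hxu
      have hxu : x ≠ u := hxu
      have hex : ∃ j, x ∈ D.earSupport j := by
        obtain ⟨y, hy⟩ := hiso x
        rcases D.edges_cover s(x, y) hy with h | ⟨⟨j, hj⟩, h⟩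
        · exact ⟨0, (sup0 D).2 (Walk.fst_mem_support_of_mem_edges _ h)⟩
        · exact ⟨j + 1, (supS D hj).2 (Walk.fst_mem_support_of_mem_edges _ h)⟩
      have hxb := hbirth x hex
      rw [mem_P]
      rcases hbx : D.birth x with _ | j
      · rw [hbx] at hxb
        exact ⟨0, by omega, hxb⟩
      · rw [hbx] at hxb
        have hj : j < D.k := by
          by_contra hk
          exact supN D hk hxb
        have hxs := (supS D hj).1 hxb
        have hxP : x ∉ (D.partialGraph j).verts := by
          rw [mem_P]
          rintro ⟨l, hl, h⟩
          have := hbl x l h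
          omega
        rw [meets D hj hxs, not_or] at hxP
        have hlong : D.IsLong (j + 1) := by
          refine Or.inr ⟨by simpa using hj, ?_⟩
          change 2 ≤ (D.path ⟨j, hj⟩).length
          obtain ⟨L, h1, h2⟩ := walk_list (D.path ⟨j, hj⟩) (D.path_length_pos _)
          rw [h1] at hxs
          have hxL : x ∈ L := by
            simp at hxs
            tauto
          have h3 := congrArg List.length h1
          simp at h3
          have := List.length_pos_of_mem hxL
          omega
        have h4 := hlast (j + 1) (by omega) hlong
        rcases Nat.lt_or_eq_of_le h4 with h | h
        · exact ⟨j + 1, by omega, hxb⟩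
        · exfalso
          have h5 : x ∈ D.inner (i + 1) := by
            have : j = i := by omega
            subst this
            exact (innS D hj).2 ⟨hxs, hxP⟩
          rw [hin] at h5
          exact hxu h5
  · obtain ⟨L, h1, h2⟩ := walk_list (D.path ⟨i, hi⟩) (D.path_length_pos _)
    have hnd := (D.path_isPath ⟨i, hi⟩).support_nodup
    rw [h1] at hnd
    have hsup : ∀ x, x ∈ (D.path ⟨i, hi⟩).support ↔ x = D.s ⟨i, hi⟩ ∨ x = D.t ⟨i, hi⟩ ∨ x ∈ L := by
      intro x; rw [h1]; simp; tauto
    simp only [List.nodup_cons, List.mem_append, List.mem_singleton, not_or, List.nodup_append] at hnd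
    obtain ⟨⟨n1, n2⟩, n3, -, n4⟩ := hnd
    have hLs : ∀ x ∈ L, x = u := fun x hx => by
      have : x ∈ D.inner (i + 1) := (innS D hi).2
        ⟨(hsup x).2 (Or.inr (Or.inr hx)), fun h => n1 (h ▸ hx), n4 x hx _ rfl⟩
      rw [hin] at this
      exact this
    have huL : u ∈ L := by
      have := (innS D hi).1 hub
      have h3 := (hsup u).1 this.1
      tauto
    have hLu : L = [u] := by
      rcases L with _ | ⟨x, _ | ⟨y, L⟩⟩
      · simp at huL
      · rw [hLs x (by simp)]
      · exfalso
        have := hLs x (by simp)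
        have := hLs y (by simp)
        subst x y
        simp at n3
    subst hLu
    obtain ⟨e1, e2⟩ := h2
    have e2 : s(u, D.t ⟨i, hi⟩) ∈ (D.path ⟨i, hi⟩).edges := e2
    rw [edgS D hi] at hru'
    refine ⟨_, _, n2, ?_, ?_, (Walk.adj_of_mem_edges _ e1).symm, Walk.adj_of_mem_edges _ e2⟩
    · intro h
      apply hru'
      rw [← h]
      exact e1
    · intro h
      apply hru'
      rw [← h, Sym2.eq_swap]
      exact e2

theorem no_iso [Finite V] (hG : KConnected 3 G) : ∀ x, ∃ y, G.Adj x y := by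
  intro x
  have h := (hG.2 ∅ (by simp)).preconnected
  have hc := hG.1
  have : Nontrivial V := by
    rw [← Finite.one_lt_card_iff_nontrivial]; omega
  obtain ⟨y, hy⟩ := exists_ne x
  obtain ⟨p⟩ := h ⟨x, by simp⟩ ⟨y, by simp⟩
  cases p with
  | nil => exact (hy rfl).elim
  | @cons _ z _ h q => exact ⟨z, h⟩
end
end Mond

namespace Mond
section
variable {V : Type u} {G : SimpleGraph V} {r u : V}

theorem list_walk {s t : V} {L : List V} (h : Wk G.Adj s L t) :
    ∃ p : G.Walk s t, p.support = s :: (L ++ [t]) ∧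
      ∀ e ∈ p.edges, (∃ x ∈ L, x ∈ e) ∨ (s ∈ e ∧ L = []) := by
  induction L generalizing s with
  | nil =>
    have h : G.Adj s t := h
    exact ⟨Walk.cons h Walk.nil, by simp, by simp⟩
  | cons x L ih =>
    obtain ⟨h1, h2⟩ := h
    obtain ⟨q, k1, k2⟩ := ih h2
    refine ⟨Walk.cons h1 q, by simp [k1], ?_⟩
    intro e he
    left
    rw [Walk.edges_cons, List.mem_cons] at he
    rcases he with rfl | he
    · exact ⟨x, by simp, by simp⟩
    · rcases k2 e he with ⟨y, hy, hye⟩ | ⟨h, -⟩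
      · exact ⟨y, by simp [hy], hye⟩
      · exact ⟨x, by simp, h⟩

/-- A path-ear: a walk with its two endpoints. -/
abbrev Ear (G : SimpleGraph V) : Type u := Σ p : V × V, G.Walk p.1 p.2

/-- Vertices of the first ears. -/
def vs {v0 : V} (c : G.Walk v0 v0) (E : ℕ → Ear G) (i : ℕ) : Set V :=
  {x | x ∈ c.support ∨ ∃ j, j < i ∧ x ∈ (E j).2.support}

/-- A partial non-separating ear decomposition. -/
structure Pre {v0 : V} (c : G.Walk v0 v0) (E : ℕ → Ear G) (k : ℕ) : Prop where
  cyc : c.IsCycle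
  isPath : ∀ i < k, (E i).2.IsPath
  pos : ∀ i < k, 0 < (E i).2.length
  dc : ∀ i < k, ∀ e ∈ (E i).2.edges, e ∉ c.edges
  dd : ∀ i < k, ∀ j < k, i ≠ j → ∀ e ∈ (E i).2.edges, e ∉ (E j).2.edges
  meets : ∀ i < k, ∀ x ∈ (E i).2.support, (x ∈ vs c E i ↔ (x = (E i).1.1 ∨ x = (E i).1.2))
  ns0 : ∀ x ∈ c.support, (∃ z, z ∉ vs c E 0) → ∃ y, G.Adj x y ∧ y ∉ vs c E 0
  nsS : ∀ i < k, ∀ x ∈ (E i).2.support, x ≠ (E i).1.1 → x ≠ (E i).1.2 → (∃ z, z ∉ vs c E (i + 1)) →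
    ∃ y, G.Adj x y ∧ y ∉ vs c E (i + 1)

theorem vs_congr {v0 : V} {c : G.Walk v0 v0} {E E' : ℕ → Ear G} {k : ℕ} (h : ∀ j < k, E' j = E j)
    {i : ℕ} (hi : i ≤ k) : vs c E' i = vs c E i := by
  ext x
  simp only [vs, Set.mem_ofPred_eq]
  refine or_congr Iff.rfl (exists_congr fun j => and_congr_right fun hj => ?_)
  rw [h j (by omega)]

theorem vs_succ {v0 : V} {c : G.Walk v0 v0} {E : ℕ → Ear G} {k : ℕ} {x : V} :
    x ∈ vs c E (k + 1) ↔ x ∈ vs c E k ∨ x ∈ (E k).2.support := by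
  simp only [vs, Set.mem_ofPred_eq]
  constructor
  · rintro (h | ⟨j, hj, h⟩)
    · exact Or.inl (Or.inl h)
    · rcases Nat.lt_or_eq_of_le (Nat.lt_succ_iff.1 hj) with h' | rfl
      · exact Or.inl (Or.inr ⟨j, h', h⟩)
      · exact Or.inr h
  · rintro ((h | ⟨j, hj, h⟩) | h)
    · exact Or.inl h
    · exact Or.inr ⟨j, by omega, h⟩
    · exact Or.inr ⟨k, by omega, h⟩

theorem Pre.snoc {v0 : V} {c : G.Walk v0 v0} {E : ℕ → Ear G} {k : ℕ} (P : Pre c E k) (e : Ear G)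
    (h1 : e.2.IsPath) (h2 : 0 < e.2.length) (h3 : ∀ x ∈ e.2.edges, x ∉ c.edges)
    (h4 : ∀ j < k, ∀ x ∈ e.2.edges, x ∉ (E j).2.edges)
    (h5 : ∀ x ∈ e.2.support, (x ∈ vs c E k ↔ (x = e.1.1 ∨ x = e.1.2)))
    (h6 : ∀ x ∈ e.2.support, x ≠ e.1.1 → x ≠ e.1.2 → (∃ z, z ∉ vs c E k ∧ z ∉ e.2.support) →
      ∃ y, G.Adj x y ∧ y ∉ vs c E k ∧ y ∉ e.2.support) :
    ∃ E', Pre c E' (k + 1) ∧ (∀ j < k, E' j = E j) ∧ E' k = e := by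
  have hj : ∀ j < k, Function.update E k e j = E j := fun j hj =>
    Function.update_of_ne (by omega) _ _
  have hk : Function.update E k e k = e := Function.update_self _ _ _
  refine ⟨Function.update E k e, ?_, hj, hk⟩
  generalize Function.update E k e = E' at hj hk
  subst hk
  have hv : ∀ i ≤ k, vs c E' i = vs c E i := fun i hi => vs_congr hj hi
  have hsplit : ∀ i < k + 1, i < k ∨ i = k := fun i hi => by omega
  refine ⟨P.cyc, ?_, ?_, ?_, ?_, ?_, ?_, ?_⟩
  · intro i hi
    rcases hsplit i hi with h | rfl
    · rw [hj i h]; exact P.isPath i h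
    · exact h1
  · intro i hi
    rcases hsplit i hi with h | rfl
    · rw [hj i h]; exact P.pos i h
    · exact h2
  · intro i hi
    rcases hsplit i hi with h | rfl
    · rw [hj i h]; exact P.dc i h
    · exact h3
  · intro i hi j hj' hij
    rcases hsplit i hi with h | rfl
    · rcases hsplit j hj' with h' | rfl
      · rw [hj i h, hj j h']; exact P.dd i h j h' hij
      · rw [hj i h]; exact fun x hx hx' => h4 i h x hx' hx
    · rcases hsplit j hj' with h' | rfl
      · rw [hj j h']; exact h4 j h'
      · exact (hij rfl).elim
  · intro i hi
    rcases hsplit i hi with h | rfl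
    · rw [hj i h, hv i h.le]; exact P.meets i h
    · rw [hv i le_rfl]; exact h5
  · rw [hv 0 (Nat.zero_le _)]; exact P.ns0
  · intro i hi
    rcases hsplit i hi with h | rfl
    · rw [hj i h, hv (i + 1) (by omega)]; exact P.nsS i h
    · intro x hx hxs hxt
      simp only [vs_succ, not_or, hv i le_rfl]
      exact h6 x hx hxs hxt

theorem Pre.edge_vs {v0 : V} {c : G.Walk v0 v0} {E : ℕ → Ear G} {k : ℕ} {x : V} {e : Sym2 V}
    (hx : x ∈ e) (he : e ∈ c.edges ∨ ∃ j, j < k ∧ e ∈ (E j).2.edges) : x ∈ vs c E k := by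
  have hm : ∀ {s t : V} (p : G.Walk s t), e ∈ p.edges → x ∈ p.support := by
    intro s t p hp
    induction e with
    | h a b =>
      rcases Sym2.mem_iff.1 hx with rfl | rfl
      · exact Walk.fst_mem_support_of_mem_edges _ hp
      · exact Walk.snd_mem_support_of_mem_edges _ hp
  rcases he with he | ⟨j, hj, he⟩
  · exact Or.inl (hm _ he)
  · exact Or.inr ⟨j, hj, hm _ he⟩

/-- Adding a long ear given as a list of inner vertices. -/
theorem Pre.long {v0 : V} {c : G.Walk v0 v0} {E : ℕ → Ear G} {k : ℕ} (P : Pre c E k) {s t : V} {L : List V}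
    (hW : Wk G.Adj s L t) (hne : L ≠ []) (hnd : L.Nodup) (hL : ∀ x ∈ L, x ∉ vs c E k)
    (hs : s ∈ vs c E k) (ht : t ∈ vs c E k) (hst : s ≠ t)
    (hl : ∀ x ∈ L, (∃ z, z ∉ vs c E k ∧ z ∉ L) → ∃ y, G.Adj x y ∧ y ∉ vs c E k ∧ y ∉ L) :
    ∃ E', Pre c E' (k + 1) ∧ (∀ j < k, E' j = E j) ∧ (E' k).1 = (s, t) ∧
      (E' k).2.support = s :: (L ++ [t]) := by
  obtain ⟨p, h1, h2⟩ := list_walk hW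
  have hsL : s ∉ L := fun h => hL s h hs
  have htL : t ∉ L := fun h => hL t h ht
  have hed : ∀ e ∈ p.edges, ∃ x, x ∈ e ∧ x ∉ vs c E k := by
    intro e he
    rcases h2 e he with ⟨x, hx, hxe⟩ | ⟨-, h⟩
    · exact ⟨x, hxe, hL x hx⟩
    · exact (hne h).elim
  have hsup : ∀ x, x ∈ p.support ↔ x = s ∨ x = t ∨ x ∈ L := by
    intro x; rw [h1]; simp; tauto
  suffices hsn : ∃ E', Pre c E' (k + 1) ∧ (∀ j < k, E' j = E j) ∧ E' k = ⟨(s, t), p⟩ by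
    obtain ⟨E', k1, k2, k3⟩ := hsn
    exact ⟨E', k1, k2, by rw [k3], by rw [k3]; exact h1⟩
  refine P.snoc ⟨(s, t), p⟩ ?_ ?_ ?_ ?_ ?_ ?_
  · rw [Walk.isPath_def]
    change p.support.Nodup
    rw [h1]
    simp only [List.nodup_cons, List.mem_append, List.mem_singleton, not_or, List.nodup_append]
    refine ⟨⟨hsL, hst⟩, hnd, by simp, ?_⟩
    rintro x hx _ rfl rfl
    exact htL hx
  · change 0 < p.length
    have := congrArg List.length h1
    simp at this
    omega
  · intro e he hc
    obtain ⟨x, hx, hx'⟩ := hed e he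
    exact hx' (Pre.edge_vs hx (Or.inl hc))
  · intro j hj e he hc
    obtain ⟨x, hx, hx'⟩ := hed e he
    exact hx' (Pre.edge_vs hx (Or.inr ⟨j, hj, hc⟩))
  · intro x hx
    rcases (hsup x).1 hx with rfl | rfl | h
    · exact ⟨fun _ => Or.inl rfl, fun _ => hs⟩
    · exact ⟨fun _ => Or.inr rfl, fun _ => ht⟩
    · refine ⟨fun h' => (hL x h h').elim, ?_⟩
      rintro (h' | h')
      · have h' : x = s := h'
        exact (hsL (h' ▸ h)).elim
      · have h' : x = t := h'
        exact (htL (h' ▸ h)).elim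
  · intro x hx hxs hxt
    rintro ⟨z, hz, hz'⟩
    have hz' : ¬ z ∈ p.support := hz'
    rw [hsup] at hz'
    have hxL : x ∈ L := by
      rcases (hsup x).1 hx with h | h | h
      exacts [(hxs h).elim, (hxt h).elim, h]
    obtain ⟨y, h3, h4, h5⟩ := hl x hxL ⟨z, hz, fun h => hz' (Or.inr (Or.inr h))⟩
    refine ⟨y, h3, h4, ?_⟩
    change ¬ y ∈ p.support
    rw [hsup]
    rintro (rfl | rfl | h)
    exacts [h4 hs, h4 ht, h5 h]

theorem NS_Pre {S : Set V} (h : NS G r S) (hu : u ∉ S) (hru : G.Adj r u) :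
    S = {r} ∨ ∃ (c : G.Walk r r) (E : ℕ → Ear G) (k : ℕ), Pre c E k ∧ vs c E k = S := by
  induction h with
  | base => exact Or.inl rfl
  | @step' S s t L hS hW hne hnd hL hs ht hst hl ih =>
    right
    simp only [Set.mem_ofPred_eq, not_or] at hu
    rcases ih hu.1 with rfl | ⟨c, E, k, P, rfl⟩
    · have hs : s = r := hs
      have ht : t = r := ht
      subst hs ht
      have hlen : 2 ≤ L.length := by
        rcases hst with h | h
        · exact (h rfl).elim
        · exact h.2
      have hrL : t ∉ L := fun h => hL t h rfl
      rcases L with _ | ⟨x, L⟩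
      · exact (hne rfl).elim
      obtain ⟨hx, hW⟩ := hW
      obtain ⟨q, h1, h2⟩ := list_walk hW
      have hLne : L ≠ [] := by rintro rfl; simp at hlen
      simp only [List.nodup_cons, List.mem_cons, not_or] at hnd hrL hu hl
      have hcyc : (Walk.cons hx q).IsCycle := by
        rw [Walk.cons_isCycle_iff, Walk.isPath_def, h1]
        constructor
        · simp only [List.nodup_cons, List.mem_append, List.mem_singleton, not_or, List.nodup_append]
          refine ⟨⟨hnd.1, fun h => hrL.1 h.symm⟩, hnd.2, by simp, ?_⟩
          rintro y hy _ rfl rfl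
          exact hrL.2 hy
        · intro he
          rcases h2 _ he with ⟨y, hy, hye⟩ | ⟨-, h⟩
          · rcases Sym2.mem_iff.1 hye with rfl | rfl
            · exact hrL.2 hy
            · exact hnd.1 hy
          · exact hLne h
      have hsup : ∀ y, y ∈ (Walk.cons hx q).support ↔ y = t ∨ y = x ∨ y ∈ L := by
        intro y
        rw [Walk.support_cons, h1]; simp; tauto
      have hvs : ∀ E y, y ∈ vs (Walk.cons hx q) E 0 ↔ y = t ∨ y = x ∨ y ∈ L := by
        intro E y
        rw [← hsup]
        simp [vs]
      refine ⟨Walk.cons hx q, fun _ => ⟨(t, t), Walk.nil⟩, 0, ⟨hcyc, ?_, ?_, ?_, ?_, ?_, ?_, ?_⟩, ?_⟩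
      · intro i hi; omega
      · intro i hi; omega
      · intro i hi; omega
      · intro i hi; omega
      · intro i hi; omega
      · intro y hy _
        simp only [hvs]
        rcases (hsup y).1 hy with rfl | hy
        · refine ⟨u, hru, ?_⟩
          rintro (h | h)
          · exact hu.1 h
          · exact (not_or.2 hu.2) h
        · obtain ⟨z, h3, h4, h5⟩ := hl y hy
          exact ⟨z, h3, not_or.2 ⟨h4, not_or.2 h5⟩⟩
      · intro i hi; omega
      · ext y
        rw [hvs]
        simp
    · have hst : s ≠ t := by
        rcases hst with h | ⟨h, -⟩
        · exact h
        exfalso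
        obtain ⟨L, h1, h2⟩ := walk_list c (by have := P.cyc.three_le_length; omega)
        have hlen := P.cyc.three_le_length
        have h3 := congrArg List.length h1
        simp at h3
        rcases L with _ | ⟨x, L⟩
        · simp at h3; omega
        have hrx : G.Adj r x := Walk.adj_of_mem_edges _ h2.1
        have hx : x ∈ vs c E k := Or.inl (by rw [h1]; simp)
        rw [h] at hx
        exact hrx.ne hx.symm
      obtain ⟨E', k1, k2, -, k3⟩ := P.long hW hne hnd hL hs ht hst
        (fun x hx _ => by
          obtain ⟨y, h1, h2, h3⟩ := hl x hx
          exact ⟨y, h1, h2, h3⟩)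
      refine ⟨c, E', k + 1, k1, ?_⟩
      ext x
      rw [vs_succ, vs_congr k2 le_rfl, k3]
      simp only [Set.mem_ofPred_eq, List.mem_cons, List.mem_append, List.not_mem_nil, or_false]
      constructor
      · rintro (h | rfl | h | rfl)
        exacts [Or.inl h, Or.inl hs, Or.inr h, Or.inl ht]
      · rintro (h | h)
        exacts [Or.inl h, Or.inr (Or.inr (Or.inl h))]

/-- Edges not yet covered. -/
def unc {v0 : V} (c : G.Walk v0 v0) (E : ℕ → Ear G) (k : ℕ) : Set (Sym2 V) :=
  {e | e ∈ G.edgeSet ∧ e ∉ c.edges ∧ ∀ j < k, e ∉ (E j).2.edges}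

theorem Pre.fill [Finite V] {v0 : V} {c : G.Walk v0 v0} (n : ℕ) : ∀ {E : ℕ → Ear G} {k : ℕ},
    Pre c E k → (∀ x, x ∈ vs c E k) → (unc c E k).ncard ≤ n →
    ∃ E' k', Pre c E' k' ∧ k ≤ k' ∧ (∀ j < k, E' j = E j) ∧
      (∀ j, k ≤ j → j < k' → (E' j).2.length = 1) ∧ unc c E' k' = ∅ := by
  induction n with
  | zero =>
    intro E k P _ h
    refine ⟨E, k, P, le_rfl, fun _ _ => rfl, fun j h1 h2 => by omega, ?_⟩
    exact (Set.ncard_eq_zero (Set.toFinite _)).1 (by omega)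
  | succ n ih =>
    intro E k P hv h
    rcases Set.eq_empty_or_nonempty (unc c E k) with he | ⟨e, he⟩
    · exact ⟨E, k, P, le_rfl, fun _ _ => rfl, fun j h1 h2 => by omega, he⟩
    induction e with
    | h a b =>
      obtain ⟨hab, hc, hj⟩ := he
      have hab : G.Adj a b := hab
      obtain ⟨E', k1, k2, k3⟩ := P.snoc ⟨(a, b), Walk.cons hab Walk.nil⟩ (by simp [hab.ne]) (by simp)
        (by simpa using hc) (by simpa using hj)
        (by
          intro x hx
          simp only [hv, true_iff]
          simpa using hx) (by
          rintro x _ _ _ ⟨z, hz, -⟩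
          exact (hz (hv z)).elim)
      have hv' : ∀ x, x ∈ vs c E' (k + 1) := fun x => by
        rw [vs_succ, vs_congr k2 le_rfl]; exact Or.inl (hv x)
      have hun : unc c E' (k + 1) ⊂ unc c E k := by
        refine ⟨?_, ?_⟩
        · rintro e ⟨h1, h2, h3⟩
          refine ⟨h1, h2, fun j hj => ?_⟩
          rw [← k2 j hj]
          exact h3 j (by omega)
        · intro hsub
          have := (hsub ⟨hab, hc, hj⟩).2.2 k (by omega)
          rw [k3] at this
          simp at this
      obtain ⟨E'', k'', l1, l2, l3, l4, l5⟩ := ih k1 hv' (by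
        have := Set.ncard_lt_ncard hun (Set.toFinite _)
        omega)
      refine ⟨E'', k'', l1, by omega, fun j hj => (l3 j (by omega)).trans (k2 j hj), fun j h1 h2 => ?_, l5⟩
      rcases Nat.lt_or_eq_of_le h1 with h | rfl
      · exact l4 j (by omega) h2
      · rw [l3 k (by omega), k3]; rfl

theorem Mon_to_D [Finite V] (h : Mon G r u) : ∃ D : EarDecomposition G, IsMondshein D r u := by
  obtain ⟨hNS, hru, s, t, hst, hsr, htr, hs, ht⟩ := h
  rcases NS_Pre hNS (u := u) (by simp) hru with h | ⟨c, E, k, P, hvs⟩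
  · exfalso
    have : s ∈ ({u}ᶜ : Set V) := fun e => hs.ne (Eq.symm e)
    rw [h] at this
    exact hsr this
  have hmem : ∀ x, x ∈ vs c E k ↔ x ≠ u := fun x => by rw [hvs]; rfl
  obtain ⟨E₁, P₁, hE₁, hst₁, hsup₁⟩ := P.long (s := s) (t := t) (L := [u]) ⟨hs.symm, ht⟩ (by simp) (by simp)
    (by simp [hmem]) ((hmem s).2 hs.ne.symm) ((hmem t).2 ht.ne.symm) hst (by
      rintro x _ ⟨z, hz, hz'⟩
      rw [hmem] at hz
      simp at hz hz'
      exact (hz' hz).elim)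
  have hv₁ : ∀ x, x ∈ vs c E₁ (k + 1) := fun x => by
    rw [vs_succ, vs_congr hE₁ le_rfl, hmem, hsup₁]
    by_cases hx : x = u
    · right; simp [hx]
    · exact Or.inl hx
  obtain ⟨E', k', P', hk, hE', hsh, hun⟩ := P₁.fill _ hv₁ le_rfl
  have hEk : E' k = E₁ k := hE' k (by omega)
  have hvs' : ∀ x, x ∈ vs c E' k ↔ x ≠ u := fun x => by
    rw [← hmem, vs_congr (fun j hj => (hE' j (by omega)).trans (hE₁ j hj)) le_rfl]
  have hsupk : (E' k).2.support = [s, u, t] := by rw [hEk]; exact hsup₁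
  have hendk : (E' k).1 = (s, t) := by rw [hEk]; exact hst₁
  let D : EarDecomposition G :=
    { k := k'
      v0 := r
      cycle := c
      cycle_isCycle := P'.cyc
      s := fun i => (E' i).1.1
      t := fun i => (E' i).1.2
      path := fun i => (E' i).2
      path_isPath := fun i => P'.isPath i i.2
      path_length_pos := fun i => P'.pos i i.2
      edges_cover := by
        intro e he
        by_contra hcon
        rw [not_or, not_exists] at hcon
        have : e ∈ unc c E' k' := ⟨he, hcon.1, fun j hj => hcon.2 ⟨j, hj⟩⟩
        rw [hun] at this
        exact this
      cycle_path_disjoint := fun i => P'.dc i i.2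
      path_path_disjoint := fun i j hij => P'.dd i i.2 j j.2 (fun h => hij (Fin.ext h))
      meets_prev := by
        intro i x hx
        rw [← P'.meets i i.2 x hx]
        refine or_congr Iff.rfl ⟨?_, ?_⟩
        · rintro ⟨j, hj, h⟩
          exact ⟨j, hj, h⟩
        · rintro ⟨j, hj, h⟩
          exact ⟨⟨j, hj.trans i.2⟩, hj, h⟩ }
  have hDk : D.k = k' := rfl
  have hPv : ∀ i ≤ k', ∀ x, x ∈ (D.partialGraph i).verts ↔ x ∈ vs c E' i := by
    intro i hi x
    rw [mem_P]
    constructor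
    · rintro ⟨j, hj, hx⟩
      rcases j with _ | j
      · exact Or.inl ((sup0 D).1 hx)
      · exact Or.inr ⟨j, by omega, (supS D (by omega)).1 hx⟩
    · rintro (hx | ⟨j, hji, hx⟩)
      · exact ⟨0, by omega, (sup0 D).2 hx⟩
      · exact ⟨j + 1, by omega, (supS D (by omega)).2 hx⟩
  have hkk : k < D.k := by omega
  have hbirth : D.birth u = k + 1 := by
    have hmem : u ∈ D.earSupport (k + 1) := by
      rw [supS D hkk]
      change u ∈ (E' k).2.support
      rw [hsupk]; simp
    refine le_antisymm (Nat.sInf_le hmem) ?_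
    by_contra hlt
    have h1 : u ∈ D.earSupport (D.birth u) := Nat.sInf_mem (s := {i | u ∈ D.earSupport i}) ⟨_, hmem⟩
    have h2 : u ∈ (D.partialGraph k).verts := (mem_P D).2 ⟨_, by omega, h1⟩
    rw [hPv k (by omega), hvs'] at h2
    exact h2 rfl
  have hlenk : (E' k).2.length = 2 := by
    have := congrArg List.length hsupk
    simpa using this
  refine ⟨D, ?_, ?_, ?_, ?_, ?_, ?_⟩
  · rw [sup0]; exact c.start_mem_support
  · rw [hbirth]
    exact Or.inr ⟨hkk, hlenk.ge⟩
  · rw [hbirth]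
    intro j hj hl
    by_contra hlt
    rcases hl with rfl | ⟨h1, h2⟩
    · omega
    · have h2 : 2 ≤ (E' (j - 1)).2.length := h2
      have := hsh (j - 1) (by omega) h1
      omega
  · rw [hbirth]
    ext x
    rw [innS D hkk]
    change (x ∈ (E' k).2.support ∧ x ≠ (E' k).1.1 ∧ x ≠ (E' k).1.2) ↔ x = u
    rw [hsupk, hendk]
    have := hs.ne
    have := ht.ne
    simp
    constructor
    · tauto
    · rintro rfl
      tauto
  · rw [hbirth, edgS D hkk]
    intro he
    have he : s(r, u) ∈ (E' k).2.edges := he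
    have h1 := Walk.fst_mem_support_of_mem_edges _ he
    rw [hsupk] at h1
    simp only [List.mem_cons, List.not_mem_nil, or_false] at h1
    rcases h1 with h1 | h1 | h1
    exacts [hsr h1.symm, hru.ne h1, htr h1.symm]
  · intro i hi hne x hx
    obtain ⟨z, hz⟩ := hne
    have hz : z ∉ vs c E' i := fun h => hz ((hPv i hi z).2 h)
    suffices ∃ y, G.Adj x y ∧ y ∉ vs c E' i by
      obtain ⟨y, h1, h2⟩ := this
      exact ⟨y, fun h => h2 ((hPv i hi y).1 h), h1⟩
    rcases i with _ | i
    · exact P'.ns0 x ((inn0 D).1 hx) ⟨z, hz⟩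
    · have hik : i < D.k := by omega
      obtain ⟨h1, h2, h3⟩ := (innS D hik).1 hx
      exact P'.nsS i hik x h1 h2 h3 ⟨z, hz⟩
end
end Mond

/-- Path Replacement Lemma, existence form. Let `G` be a finite simple
3-connected graph with an edge `ru` and let `D` be a Mondshein sequence of `G` avoiding
`ru`. If `G'` is obtained from `G` by a single BG-operation, then `G'` has a Mondshein
sequence avoiding the edge of `G'` corresponding to `ru` (namely `ru` itself, or `rv` if
the operation subdivides `ru` with `v`, or `rw` if it subdivides `ru` with `w`). -/
theorem mondshein_of_bgOp {V W : Type u} [Fintype V] [Fintype W] [DecidableEq V]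
    (G : SimpleGraph V) (G' : SimpleGraph W) (r u : V) (hru : G.Adj r u)
    (hG : KConnected 3 G) (D : EarDecomposition G) (hD : IsMondshein D r u) :
    -- vertex-vertex-addition
    (∀ (e : V ≃ W) (x y : V), x ≠ y → ¬G.Adj x y →
      (∀ z z' : V, G'.Adj (e z) (e z') ↔
        (G.Adj z z' ∨ (z = x ∧ z' = y) ∨ (z = y ∧ z' = x))) →
      ∃ D' : EarDecomposition G', IsMondshein D' (e r) (e u)) ∧
    -- edge-vertex-addition (subdividing `ab` with `v`, adding `v w₀`)
    (∀ (f : V ↪ W) (v : W) (a b w₀ : V),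
      (∀ x, f x ≠ v) → (∀ z : W, z = v ∨ ∃ x, f x = z) →
      G.Adj a b → w₀ ≠ a → w₀ ≠ b →
      (∀ x y : V, G'.Adj (f x) (f y) ↔ (G.Adj x y ∧ s(x, y) ≠ s(a, b))) →
      (∀ x : V, G'.Adj v (f x) ↔ (x = a ∨ x = b ∨ x = w₀)) →
      ∃ D' : EarDecomposition G',
        IsMondshein D' (f r) (if s(a, b) = s(r, u) then v else f u)) ∧
    -- edge-edge-addition (subdividing `ab` with `v` and `cd` with `w`, adding `vw`)
    (∀ (f : V ↪ W) (v w : W) (a b c d : V),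
      v ≠ w → (∀ x, f x ≠ v ∧ f x ≠ w) → (∀ z : W, z = v ∨ z = w ∨ ∃ x, f x = z) →
      G.Adj a b → G.Adj c d → s(a, b) ≠ s(c, d) →
      (∀ x y : V, G'.Adj (f x) (f y) ↔
        (G.Adj x y ∧ s(x, y) ≠ s(a, b) ∧ s(x, y) ≠ s(c, d))) →
      (∀ x : V, G'.Adj v (f x) ↔ (x = a ∨ x = b)) →
      (∀ x : V, G'.Adj w (f x) ↔ (x = c ∨ x = d)) →
      G'.Adj v w →
      ∃ D' : EarDecomposition G',
        IsMondshein D' (f r)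
          (if s(a, b) = s(r, u) then v else if s(c, d) = s(r, u) then w else f u)) := by
  classical
  have hM : Mond.Mon G r u := Mond.D_to_Mon D hD hru (Mond.no_iso hG)
  refine ⟨?_, ?_, ?_⟩
  · intro e x y _ _ hadj
    exact Mond.Mon_to_D (Mond.Mon_VV hM e fun z z' h => (hadj z z').2 (Or.inl h))
  · intro f v a b w₀ hv hc hab hwa hwb hadj hav
    have h := Mond.Mon_EV hM f v a b w₀ hv hc hab hwa hwb hadj hav
    split_ifs with h1
    · exact Mond.Mon_to_D (h.1 h1)
    · exact Mond.Mon_to_D (h.2 h1)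
  · intro f v w a b c d hvw hv hc hab hcd hne hadj hav haw hvw'
    have h := Mond.Mon_EE hM f v w a b c d hvw hv hc hab hcd hne hadj hav haw hvw'
    split_ifs with h1 h2
    · exact Mond.Mon_to_D (h.1 h1)
    · exact Mond.Mon_to_D (h.2.1 h2)
    · exact Mond.Mon_to_D (h.2.2 h1 h2)
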